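/- arXiv:1207.1831 — 2 statements merged into one kernel-verified Lean document; each statement's English description precedes it below -/
import Mathlib

section
/- There is an absolute constant C > 0 with the following property. Let (X, dist) be a metric space, P ⊆ X, let t ≥ 1 and ρ ≥ 2 be reals, and let SpSz, Δ, Λ : [0,∞) → [0,∞) be monotone nondecreasing functions with SpSz convex and SpSz(0) = 0. Suppose that every finite subset Q ⊆ P with |Q| = m admits a t-spanner H with at most SpSz(m) edges, degree at most Δ(m), and hop-diameter at most Λ(m). Then for every finite subset Q ⊆ P with |Q| = n ≥ 2 and every ε with 0 < ε ≤ t, there exists a (t+ε)-spanner H' for Q with at most C·SpSz(n)·(1 + log_ρ(t/ε)) edges, degree at most C·(Δ(n)·(1 + log_ρ(t/ε)) + ρ), hop-diameter at most C·(Λ(n) + log_ρ n + α(ρ)), and lightness at most C·(SpSz(n)/n)·ρ·(log_ρ n)·(t³/ε). -/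
open scoped BigOperators

namespace Stmt3

variable {P : Type} [MetricSpace P]

/-- The weight of an edge (an unordered pair of points) is the distance between its
endpoints. -/
noncomputable def edgeWeight (e : Sym2 P) : ℝ :=
  Sym2.lift ⟨fun p q => dist p q, fun p q => dist_comm p q⟩ e

/-- The total weight `ω(H)` of a graph, given as a finite set of edges. -/
noncomputable def totalWeight (H : Finset (Sym2 P)) : ℝ :=
  ∑ e ∈ H, edgeWeight e

/-- `H` is a graph on `P`: a finite set of unordered pairs of *distinct* points. -/
def IsGraphOn (H : Finset (Sym2 P)) : Prop :=
  ∀ e ∈ H, ¬ e.IsDiag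

open Classical in
/-- The degree of the point `p` in the graph `H`: the number of edges incident on `p`. -/
noncomputable def degree (H : Finset (Sym2 P)) (p : P) : ℕ :=
  (H.filter (fun e => p ∈ e)).card

/-- A `t`-spanner path with `k` edges between `p` and `q` in the graph `H`. -/
def IsSpannerPath (H : Finset (Sym2 P)) (t : ℝ) (p q : P) (k : ℕ) : Prop :=
  ∃ x : Fin (k + 1) → P, x 0 = p ∧ x (Fin.last k) = q ∧
    (∀ i : Fin k, s(x i.castSucc, x i.succ) ∈ H) ∧
    ∑ i : Fin k, dist (x i.castSucc) (x i.succ) ≤ t * dist p q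

/-- `H` is a `t`-spanner: every pair of points admits a `t`-spanner path. -/
def IsSpanner (H : Finset (Sym2 P)) (t : ℝ) : Prop :=
  ∀ p q : P, ∃ k : ℕ, IsSpannerPath H t p q k

/-- The graph `T` connects all the points of `P`. -/
def IsConnectedOn (T : Finset (Sym2 P)) : Prop :=
  ∀ p q : P, ∃ (k : ℕ) (x : Fin (k + 1) → P), x 0 = p ∧ x (Fin.last k) = q ∧
    ∀ i : Fin k, s(x i.castSucc, x i.succ) ∈ T

/-- `ω(MST(P))`: the minimum weight of a connected graph on `P` with `|P| - 1` edges. -/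
noncomputable def mstWeight (P : Type) [MetricSpace P] [Fintype P] : ℝ :=
  sInf {w : ℝ | ∃ T : Finset (Sym2 P), IsGraphOn T ∧ IsConnectedOn T ∧
    T.card = Fintype.card P - 1 ∧ totalWeight T = w}

/-- The inverse Ackermann function: the least `k ≥ 1` with `A(k,k) ≥ x`. -/
noncomputable def invAck (x : ℝ) : ℕ :=
  sInf {k : ℕ | 1 ≤ k ∧ x ≤ ack k k}

/-- A metric space has doubling dimension at most `d` if every ball can be covered
by at most `2^d` balls of half its radius. -/
def DoublingDimLE (P : Type) [MetricSpace P] (d : ℕ) : Prop :=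
  ∀ (x : P) (r : ℝ), ∃ S : Finset P, S.card ≤ 2 ^ d ∧
    Metric.ball x r ⊆ ⋃ y ∈ S, Metric.ball y (r / 2)

section Clustering

open Classical in
/-- A finite set splits into groups of at most `2 * m` elements, each with a chosen member, such
that there are few groups and no group is a singleton unless the whole set is. -/
lemma exists_grouping {V : Type} (m : ℕ) (hm : 2 ≤ m) (A : Finset V) :
    ∃ g : V → V, (∀ a ∈ A, g a ∈ A) ∧ (∀ a ∈ A, g (g a) = g a) ∧
      (∀ y, (A.filter (fun a => g a = y)).card ≤ 2 * m) ∧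
      (2 ≤ A.card → ∀ a ∈ A, ∃ b ∈ A, b ≠ a ∧ g b = g a) ∧
      m * (A.image g).card ≤ m + A.card := by
  induction hn : A.card using Nat.strong_induction_on generalizing A with
  | _ n ih =>
  subst hn
  rcases A.eq_empty_or_nonempty with rfl | ⟨a₀, ha₀⟩
  · exact ⟨id, by simp⟩
  by_cases hlt : A.card < 2 * m
  · refine ⟨fun _ => a₀, fun _ _ => ha₀, fun _ _ => rfl,
      fun y => (Finset.card_filter_le _ _).trans hlt.le, fun h2 a _ => ?_, ?_⟩
    · obtain ⟨b, hb, hba⟩ := Finset.exists_mem_ne (by omega : 1 < A.card) a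
      exact ⟨b, hb, hba, rfl⟩
    · have h1 : (A.image fun _ => a₀).card ≤ 1 := by
        rw [Finset.card_le_one]; simp
      have := Nat.mul_le_mul_left m h1
      omega
  · push Not at hlt
    obtain ⟨B, hBA, hB⟩ := Finset.exists_subset_card_eq (by omega : m ≤ A.card)
    have hcard : (A \ B).card = A.card - m := by rw [Finset.card_sdiff_of_subset hBA, hB]
    obtain ⟨g, hg1, hg2, hg3, hg4, hg5⟩ := ih _ (by omega) (A \ B) rfl
    obtain ⟨b₀, hb₀⟩ : B.Nonempty := Finset.card_pos.mp (by omega)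
    have hmem : ∀ a ∈ A, a ∉ B → g a ∈ A ∧ g a ∉ B := fun a ha haB =>
      Finset.mem_sdiff.mp (hg1 a (Finset.mem_sdiff.mpr ⟨ha, haB⟩))
    refine ⟨fun a => if a ∈ B then b₀ else g a, ?_, ?_, ?_, ?_, ?_⟩
    · intro a ha
      by_cases haB : a ∈ B
      · simpa [haB] using hBA hb₀
      · simpa [haB] using (hmem a ha haB).1
    · intro a ha
      by_cases haB : a ∈ B
      · simp [haB, hb₀]
      · simp [haB, (hmem a ha haB).2, hg2 a (Finset.mem_sdiff.mpr ⟨ha, haB⟩)]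
    · intro y
      by_cases hy : y ∈ B
      · refine (Finset.card_le_card (t := B) ?_).trans (by omega)
        intro a ha
        simp only [Finset.mem_filter] at ha
        by_contra haB
        rw [if_neg haB] at ha
        exact (hmem a ha.1 haB).2 (ha.2 ▸ hy)
      · refine (Finset.card_le_card ?_).trans (hg3 y)
        intro a ha
        simp only [Finset.mem_filter] at ha
        have haB : a ∉ B := fun h => by
          rw [if_pos h] at ha
          exact hy (ha.2 ▸ hb₀)
        rw [if_neg haB] at ha
        exact Finset.mem_filter.mpr ⟨Finset.mem_sdiff.mpr ⟨ha.1, haB⟩, ha.2⟩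
    · intro _ a ha
      by_cases haB : a ∈ B
      · obtain ⟨b, hb, hba⟩ := Finset.exists_mem_ne (by omega : 1 < B.card) a
        exact ⟨b, hBA hb, hba, by simp [hb, haB]⟩
      · obtain ⟨b, hb, hba, hgb⟩ := hg4 (by omega) a (Finset.mem_sdiff.mpr ⟨ha, haB⟩)
        rw [Finset.mem_sdiff] at hb
        exact ⟨b, hb.1, hba, by simp [hb.2, haB, hgb]⟩
    · have hsub : (A.image fun a => if a ∈ B then b₀ else g a) ⊆
          insert b₀ ((A \ B).image g) := by
        intro y hy
        obtain ⟨a, ha, rfl⟩ := Finset.mem_image.mp hy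
        by_cases haB : a ∈ B
        · simp [haB]
        · simp only [haB, if_false]
          exact Finset.mem_insert_of_mem
            (Finset.mem_image_of_mem _ (Finset.mem_sdiff.mpr ⟨ha, haB⟩))
      have h1 := (Finset.card_le_card hsub).trans (Finset.card_insert_le _ _)
      have h2 := Nat.mul_le_mul_left m h1
      rw [Nat.mul_add] at h2
      omega

variable {V : Type} [MetricSpace V]

/-- The points of `S` have pairwise distances at least `σ`. -/
def IsSeparatedBy (σ : ℝ) (S : Finset V) : Prop :=
  ∀ x ∈ S, ∀ y ∈ S, x ≠ y → σ ≤ dist x y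

open Classical in
/-- Every finite set contains a separated set that is also a net. -/
lemma exists_separated_net {σ : ℝ} (hσ : 0 < σ) (N : Finset V) :
    ∃ S ⊆ N, IsSeparatedBy σ S ∧ ∀ y ∈ N, ∃ x ∈ S, dist y x < σ := by
  obtain ⟨S, hS, hmax⟩ := Finset.exists_max_image
    (N.powerset.filter (fun S => IsSeparatedBy σ S)) Finset.card
    ⟨∅, Finset.mem_filter.mpr ⟨Finset.empty_mem_powerset _, by simp [IsSeparatedBy]⟩⟩
  rw [Finset.mem_filter, Finset.mem_powerset] at hS
  refine ⟨S, hS.1, hS.2, fun y hy => ?_⟩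
  by_contra! hfar
  have hyS : y ∉ S := fun h => by simpa [hσ.not_ge] using hfar y h
  have hins : insert y S ∈ N.powerset.filter (fun S => IsSeparatedBy σ S) := by
    rw [Finset.mem_filter, Finset.mem_powerset]
    refine ⟨Finset.insert_subset hy hS.1, ?_⟩
    intro a ha b hb hab
    rcases Finset.mem_insert.mp ha with rfl | ha'
    · rcases Finset.mem_insert.mp hb with rfl | hb'
      · exact absurd rfl hab
      · exact hfar b hb'
    · rcases Finset.mem_insert.mp hb with rfl | hb'
      · rw [dist_comm]; exact hfar a ha'
      · exact hS.2 a ha' b hb' hab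
  have := hmax _ hins
  rw [Finset.card_insert_of_notMem hyS] at this
  omega

open Classical in
/-- A finite set of points splits into few groups of bounded size and small radius, such that
singleton groups are isolated. -/
lemma exists_metric_grouping {σ : ℝ} (hσ : 0 < σ) {m : ℕ} (hm : 2 ≤ m) (N : Finset V) :
    ∃ (g : V → V) (S : Finset V), IsSeparatedBy σ S ∧
      (∀ y ∈ N, g y ∈ N) ∧ (∀ y ∈ N, g (g y) = g y) ∧ (∀ y ∈ N, dist y (g y) ≤ 2 * σ) ∧
      (∀ y ∈ N, (N.filter (fun a => g a = g y)).card ≤ 2 * m) ∧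
      (∀ y ∈ N, (∀ z ∈ N, g z = g y → z = y) → ∀ z ∈ N, z ≠ y → σ / 2 ≤ dist y z) ∧
      m * (N.image g).card ≤ m * S.card + N.card := by
  obtain ⟨S, hSN, hsep, hnet⟩ := exists_separated_net hσ N
  have hnear : ∀ y, ∃ x, y ∈ N → x ∈ S ∧ ∀ z ∈ S, dist y x ≤ dist y z := by
    intro y
    by_cases hy : y ∈ N
    · obtain ⟨x₀, hx₀, -⟩ := hnet y hy
      obtain ⟨x, hx, hmin⟩ := Finset.exists_min_image S (fun x => dist y x) ⟨x₀, hx₀⟩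
      exact ⟨x, fun _ => ⟨hx, hmin⟩⟩
    · exact ⟨y, fun h => absurd h hy⟩
  choose π hπ using hnear
  have hπσ : ∀ y ∈ N, dist y (π y) < σ := fun y hy => by
    obtain ⟨x, hx, hlt⟩ := hnet y hy
    exact ((hπ y hy).2 x hx).trans_lt hlt
  have hπS : ∀ x ∈ S, π x = x := fun x hx => by
    have := (hπ x (hSN hx)).2 x hx
    rw [dist_self] at this
    exact (dist_le_zero.mp this).symm
  choose f hf1 hf2 hf3 hf4 hf5 using
    fun x : V => exists_grouping m hm (N.filter (fun y => π y = x))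
  have hcell : ∀ y ∈ N, y ∈ N.filter (fun z => π z = π y) := fun y hy =>
    Finset.mem_filter.mpr ⟨hy, rfl⟩
  have hfm : ∀ y ∈ N, f (π y) y ∈ N ∧ π (f (π y) y) = π y := fun y hy =>
    Finset.mem_filter.mp (hf1 _ y (hcell y hy))
  refine ⟨fun y => f (π y) y, S, hsep, fun y hy => (hfm y hy).1, ?_, ?_, ?_, ?_, ?_⟩
  · intro y hy
    simp only [(hfm y hy).2]
    exact hf2 _ y (hcell y hy)
  · intro y hy
    have h1 := hπσ y hy
    have h2 := hπσ _ (hfm y hy).1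
    rw [(hfm y hy).2, dist_comm] at h2
    linarith [dist_triangle y (π y) (f (π y) y)]
  · intro y hy
    refine (Finset.card_le_card ?_).trans (hf3 (π y) (f (π y) y))
    intro a ha
    simp only [Finset.mem_filter] at ha
    have hπa : π a = π y := by
      rw [← (hfm a ha.1).2, ha.2, (hfm y hy).2]
    refine Finset.mem_filter.mpr ⟨Finset.mem_filter.mpr ⟨ha.1, hπa⟩, ?_⟩
    rw [← ha.2, hπa]
  · intro y hy hsingle z hz hzy
    have honly : ∀ w ∈ N, π w = π y → w = y := by
      intro w hw hwy
      by_contra hne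
      have h2 : 2 ≤ (N.filter (fun z => π z = π y)).card :=
        Finset.one_lt_card.mpr ⟨w, Finset.mem_filter.mpr ⟨hw, hwy⟩, y, hcell y hy, hne⟩
      obtain ⟨b, hb, hby, hgb⟩ := hf4 (π y) h2 y (hcell y hy)
      rw [Finset.mem_filter] at hb
      exact hby (hsingle b hb.1 (by simp only [hb.2, hgb]))
    have hyS : π y = y := honly _ (hSN (hπ y hy).1) (hπS _ (hπ y hy).1)
    have hne : y ≠ π z := fun h => hzy (honly z hz (by rw [hyS, ← h]))
    have h1 := hsep y (hyS ▸ (hπ y hy).1) (π z) (hπ z hz).1 hne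
    have h2 := (hπ z hz).2 y (hyS ▸ (hπ y hy).1)
    linarith [dist_triangle y z (π z), dist_comm y z]
  · have hsub : (N.image fun y => f (π y) y) ⊆
        S.biUnion (fun x => (N.filter (fun y => π y = x)).image (f x)) := by
      intro w hw
      obtain ⟨y, hy, rfl⟩ := Finset.mem_image.mp hw
      exact Finset.mem_biUnion.mpr ⟨π y, (hπ y hy).1, Finset.mem_image_of_mem _ (hcell y hy)⟩
    calc m * (N.image fun y => f (π y) y).card
        ≤ m * ∑ x ∈ S, ((N.filter (fun y => π y = x)).image (f x)).card :=
          Nat.mul_le_mul_left _ ((Finset.card_le_card hsub).trans Finset.card_biUnion_le)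
      _ ≤ ∑ x ∈ S, (m + (N.filter (fun y => π y = x)).card) := by
          rw [Finset.mul_sum]
          exact Finset.sum_le_sum fun x _ => hf5 x
      _ = m * S.card + N.card := by
          rw [Finset.sum_add_distrib, Finset.sum_const, smul_eq_mul, mul_comm,
            ← Finset.card_eq_sum_card_fiberwise fun y hy => (hπ y hy).1]

end Clustering

section Hierarchy

/-- A clustering in which every cluster has two marked points: its representative, which also
serves as its label, and a free point reserved for later use. -/
structure Clustering (V : Type) where
  rep : V → V
  free : V → V
  rep_rep : ∀ p, rep (rep p) = rep p
  rep_free : ∀ p, rep (free p) = rep p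
  free_congr : ∀ p q, rep p = rep q → free p = free q

/-- The clustering into singletons. -/
def Clustering.discrete (V : Type) : Clustering V where
  rep := id
  free := id
  rep_rep _ := rfl
  rep_free _ := rfl
  free_congr _ _ h := h

/-- The cluster of `p` in `c` is strictly contained in its cluster in `c'`. -/
def Clustering.Grows {V : Type} (c c' : Clustering V) (p : V) : Prop :=
  ∃ q, c'.rep q = c'.rep p ∧ c.rep q ≠ c.rep p

open Classical in
/-- The set of representatives of a clustering. -/
noncomputable def Clustering.reps {V : Type} [Fintype V] (c : Clustering V) : Finset V :=
  Finset.univ.image c.rep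

lemma Clustering.mem_reps {V : Type} [Fintype V] {c : Clustering V} {p : V} :
    p ∈ c.reps ↔ c.rep p = p := by
  classical
  simp only [Clustering.reps, Finset.mem_image, Finset.mem_univ, true_and]
  exact ⟨fun ⟨q, hq⟩ => hq ▸ c.rep_rep q, fun h => ⟨p, h⟩⟩

lemma Clustering.rep_mem_reps {V : Type} [Fintype V] (c : Clustering V) (p : V) :
    c.rep p ∈ c.reps :=
  Clustering.mem_reps.mpr (c.rep_rep p)

variable {V : Type} [MetricSpace V] [Fintype V]

open Classical in
/-- `c'` arises from `c` by grouping clusters at scale `σ` into groups of size at most `2 * m`. -/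
structure Coarsens (c c' : Clustering V) (σ : ℝ) (m : ℕ) : Prop where
  rep_of_not_grows : ∀ p, ¬ c.Grows c' p → c'.rep p = c.rep p
  free_of_not_grows : ∀ p, ¬ c.Grows c' p → c'.free p = c.free p
  isolated : ∀ p q, ¬ c.Grows c' p → c.rep q ≠ c.rep p → σ / 2 ≤ dist (c.rep p) (c.rep q)
  rep_congr : ∀ p q, c.rep p = c.rep q → c'.rep p = c'.rep q
  rep_of_grows : ∀ p, c.Grows c' p → c'.rep p = p → c.free p = p
  free_of_grows : ∀ p, c.Grows c' p → c'.free p = p → c.free p = p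
  rep_ne_free : ∀ p, c.Grows c' p → c'.rep p ≠ c'.free p
  dist_rep : ∀ r, 0 ≤ r → (∀ p, dist (c.rep p) (c.free p) ≤ r) →
    ∀ p, dist (c.rep p) (c'.rep p) ≤ 4 * σ + r
  dist_free : ∀ r, 0 ≤ r → (∀ p, dist (c.rep p) (c.free p) ≤ r) →
    ∀ p, dist (c'.rep p) (c'.free p) ≤ 4 * σ + 2 * r
  card_children : ∀ p, (c.reps.filter (fun q => c'.rep q = c'.rep p)).card ≤ 2 * m
  card_reps : ∃ S : Finset V, IsSeparatedBy σ S ∧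
    m * c'.reps.card ≤ m * S.card + c.reps.card

lemma exists_coarsens (c : Clustering V) {σ : ℝ} (hσ : 0 < σ) {m : ℕ} (hm : 2 ≤ m) :
    ∃ c', Coarsens c c' σ m := by
  classical
  obtain ⟨g, S, hS, hgm, hgg, hgd, hgf, hgi, hgc⟩ := exists_metric_grouping hσ hm c.reps
  have hmarks : ∀ y, ∃ u v, ((∀ a ∈ c.reps, ∀ b ∈ c.reps, g a = y → g b = y → a = b) ∧
        u = y ∧ v = c.free y) ∨
      (∃ a ∈ c.reps, ∃ b ∈ c.reps, g a = y ∧ g b = y ∧ a ≠ b ∧ u = c.free a ∧ v = c.free b) := by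
    intro y
    by_cases h : ∀ a ∈ c.reps, ∀ b ∈ c.reps, g a = y → g b = y → a = b
    · exact ⟨y, c.free y, Or.inl ⟨h, rfl, rfl⟩⟩
    · push Not at h
      obtain ⟨a, ha, b, hb, hay, hby, hab⟩ := h
      exact ⟨c.free a, c.free b, Or.inr ⟨a, ha, b, hb, hay, hby, hab, rfl, rfl⟩⟩
  choose u v huv using hmarks
  have hrep : ∀ p, c.rep p ∈ c.reps := c.rep_mem_reps
  have hgrep : ∀ p, c.rep (g (c.rep p)) = g (c.rep p) := fun p =>
    Clustering.mem_reps.mp (hgm _ (hrep p))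
  have hfr : ∀ a ∈ c.reps, c.rep (c.free a) = a := fun a ha => by
    rw [c.rep_free, Clustering.mem_reps.mp ha]
  have hu : ∀ p, g (c.rep (u (g (c.rep p)))) = g (c.rep p) := by
    intro p
    rcases huv (g (c.rep p)) with ⟨-, h1, -⟩ | ⟨a, ha, b, hb, hay, hby, -, h1, -⟩
    · rw [h1, hgrep, hgg _ (hrep p)]
    · rw [h1, hfr a ha, hay]
  have hv : ∀ p, g (c.rep (v (g (c.rep p)))) = g (c.rep p) := by
    intro p
    rcases huv (g (c.rep p)) with ⟨-, -, h1⟩ | ⟨a, ha, b, hb, hay, hby, -, -, h1⟩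
    · rw [h1, c.rep_free, hgrep, hgg _ (hrep p)]
    · rw [h1, hfr b hb, hby]
  have hiff : ∀ p q, u (g (c.rep p)) = u (g (c.rep q)) → g (c.rep p) = g (c.rep q) := by
    intro p q h
    rw [← hu p, h, hu q]
  let c' : Clustering V :=
    { rep := fun p => u (g (c.rep p))
      free := fun p => v (g (c.rep p))
      rep_rep := fun p => by rw [hu]
      rep_free := fun p => by rw [hv]
      free_congr := fun p q h => by rw [hiff p q h] }
  have hc'r : ∀ p, c'.rep p = u (g (c.rep p)) := fun _ => rfl
  have hc'f : ∀ p, c'.free p = v (g (c.rep p)) := fun _ => rfl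
  have hsingle : ∀ p, ¬ c.Grows c' p → ∀ a ∈ c.reps, g a = g (c.rep p) → a = c.rep p := by
    intro p hp a ha hay
    by_contra hne
    refine hp ⟨a, ?_, ?_⟩
    · rw [hc'r, hc'r, Clustering.mem_reps.mp ha, hay]
    · rwa [Clustering.mem_reps.mp ha]
  have hcase : ∀ p, ¬ c.Grows c' p → g (c.rep p) = c.rep p ∧ u (g (c.rep p)) = g (c.rep p) ∧
      v (g (c.rep p)) = c.free (g (c.rep p)) := by
    intro p hp
    have h := hsingle p hp
    refine ⟨h _ (hgm _ (hrep p)) (hgg _ (hrep p)), ?_⟩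
    rcases huv (g (c.rep p)) with ⟨-, h1, h2⟩ | ⟨a, ha, b, hb, hay, hby, hab, -, -⟩
    · exact ⟨h1, h2⟩
    · exact absurd ((h a ha hay).trans (h b hb hby).symm) hab
  have hgrow : ∀ p, c.Grows c' p → ∃ a ∈ c.reps, ∃ b ∈ c.reps, g a = g (c.rep p) ∧
      g b = g (c.rep p) ∧ a ≠ b ∧ c'.rep p = c.free a ∧ c'.free p = c.free b := by
    rintro p ⟨q, hq, hqp⟩
    rcases huv (g (c.rep p)) with ⟨h1, -, -⟩ | h
    · exact absurd (h1 _ (hrep q) _ (hrep p) (hiff _ _ hq) rfl) hqp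
    · exact h
  have hfreeself : ∀ a p, c.free a = p → c.free p = p := fun a p h => by
    have h1 : c.rep p = c.rep a := by rw [← h, c.rep_free]
    rw [c.free_congr p a h1, h]
  refine ⟨c', ?_, ?_, ?_, ?_, ?_, ?_, ?_, ?_, ?_, ?_, ?_⟩
  · intro p hp
    obtain ⟨h1, h2, -⟩ := hcase p hp
    rw [hc'r, h2, h1]
  · intro p hp
    obtain ⟨h1, -, h2⟩ := hcase p hp
    rw [hc'f, h2, h1]
    exact c.free_congr _ _ (c.rep_rep p)
  · intro p q hp hq
    exact hgi _ (hrep p) (hsingle p hp) _ (hrep q) hq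
  · intro p q h
    rw [hc'r, hc'r, h]
  · intro p hp h
    obtain ⟨a, ha, b, hb, -, -, -, h1, -⟩ := hgrow p hp
    exact hfreeself a p (h1 ▸ h)
  · intro p hp h
    obtain ⟨a, ha, b, hb, -, -, -, -, h1⟩ := hgrow p hp
    exact hfreeself b p (h1 ▸ h)
  · intro p hp h
    obtain ⟨a, ha, b, hb, -, -, hab, h1, h2⟩ := hgrow p hp
    apply hab
    rw [← hfr a ha, ← hfr b hb, ← h1, ← h2, h]
  · intro r hr0 hr p
    by_cases hp : c.Grows c' p
    · obtain ⟨a, ha, b, hb, hay, -, -, h1, -⟩ := hgrow p hp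
      have d1 := hgd _ (hrep p)
      have d2 := hgd a ha
      have d3 := hr a
      rw [Clustering.mem_reps.mp ha] at d3
      rw [hay, dist_comm] at d2
      rw [h1]
      linarith [dist_triangle4 (c.rep p) (g (c.rep p)) a (c.free a)]
    · obtain ⟨h1, h2, -⟩ := hcase p hp
      rw [hc'r, h2, h1, dist_self]
      linarith
  · intro r hr0 hr p
    by_cases hp : c.Grows c' p
    · obtain ⟨a, ha, b, hb, hay, hby, -, h1, h2⟩ := hgrow p hp
      have d1 := hgd b hb
      have d2 := hgd a ha
      have d3 := hr a
      have d4 := hr b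
      rw [Clustering.mem_reps.mp ha, dist_comm] at d3
      rw [Clustering.mem_reps.mp hb] at d4
      rw [hay] at d2
      rw [hby, dist_comm] at d1
      rw [h1, h2]
      linarith [dist_triangle4 (c.free a) a b (c.free b), dist_triangle a (g (c.rep p)) b]
    · obtain ⟨h1, h2, h3⟩ := hcase p hp
      have := hr p
      rw [hc'r, hc'f, h2, h3, h1, c.free_congr _ _ (c.rep_rep p)]
      linarith
  · intro p
    refine (Finset.card_le_card ?_).trans (hgf _ (hrep p))
    intro q hq
    simp only [Finset.mem_filter] at hq ⊢
    refine ⟨hq.1, ?_⟩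
    have := hiff _ _ hq.2
    rwa [Clustering.mem_reps.mp hq.1] at this
  · refine ⟨S, hS, le_trans (Nat.mul_le_mul_left _ ?_) hgc⟩
    have : c'.reps ⊆ (c.reps.image g).image u := by
      intro y hy
      obtain ⟨p, -, rfl⟩ := Finset.mem_image.mp hy
      exact Finset.mem_image_of_mem _ (Finset.mem_image_of_mem _ (hrep p))
    exact (Finset.card_le_card this).trans Finset.card_image_le

lemma exists_hierarchy (V : Type) [MetricSpace V] [Fintype V] {σ : ℕ → ℝ} (hσ : ∀ j, 0 < σ j)
    {m : ℕ} (hm : 2 ≤ m) :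
    ∃ c : ℕ → Clustering V, c 0 = Clustering.discrete V ∧
      ∀ j, Coarsens (c j) (c (j + 1)) (σ j) m := by
  choose next hnext using fun (c : Clustering V) (j : ℕ) => exists_coarsens c (hσ j) hm
  exact ⟨fun j => Nat.rec (Clustering.discrete V) (fun i c => next c i) j, rfl,
    fun j => hnext _ j⟩

end Hierarchy

section Marks

variable {V : Type} [MetricSpace V] [Fintype V] {c : ℕ → Clustering V} {σ : ℕ → ℝ} {m : ℕ}

open Classical in
/-- The levels below `i` at which a cluster represented by `v` grows. -/
noncomputable def growthLevels (c : ℕ → Clustering V) (v : V) (i : ℕ) : Finset ℕ :=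
  (Finset.range i).filter (fun b => (c b).rep v = v ∧ (c b).Grows (c (b + 1)) v)

open Classical in
/-- The levels below `i` at which `v` becomes the representative of a grown cluster. -/
noncomputable def rootLevels (c : ℕ → Clustering V) (v : V) (i : ℕ) : Finset ℕ :=
  (Finset.range i).filter (fun b => (c b).Grows (c (b + 1)) v ∧ (c (b + 1)).rep v = v)

lemma card_growthLevels_le (hc : ∀ j, Coarsens (c j) (c (j + 1)) (σ j) m) (v : V) (i : ℕ) :
    (growthLevels c v i).card ≤ 2 := by
  classical
  suffices h : (growthLevels c v i).card + (if (c i).rep v = v then 1 else 0) +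
      (if (c i).free v = v then 1 else 0) ≤ 2 by omega
  induction i with
  | zero => simp only [growthLevels, Finset.range_zero, Finset.filter_empty, Finset.card_empty]
            split_ifs <;> omega
  | succ i ih =>
    by_cases hg : (c i).Grows (c (i + 1)) v
    · have h1 := (hc i).rep_of_grows v hg
      have h2 := (hc i).free_of_grows v hg
      have h3 := (hc i).rep_ne_free v hg
      have h4 : ¬ ((c (i + 1)).rep v = v ∧ (c (i + 1)).free v = v) := fun h =>
        h3 (h.1.trans h.2.symm)
      have hcard : (growthLevels c v (i + 1)).card ≤
          (growthLevels c v i).card + (if (c i).rep v = v then 1 else 0) := by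
        simp only [growthLevels, Finset.range_add_one, Finset.filter_insert, hg, and_true]
        split_ifs
        · exact Finset.card_insert_le _ _
        · simp
      by_cases hf : (c i).free v = v
      · rw [if_pos hf] at ih
        by_cases h5 : (c (i + 1)).rep v = v
        · rw [if_pos h5, if_neg fun h => h4 ⟨h5, h⟩]
          omega
        · rw [if_neg h5]
          split_ifs <;> omega
      · rw [if_neg fun h => hf (h1 h), if_neg fun h => hf (h2 h)]
        omega
    · have hcard : growthLevels c v (i + 1) = growthLevels c v i := by
        simp only [growthLevels, Finset.range_add_one, Finset.filter_insert, hg, and_false,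
          if_false]
      rw [hcard, (hc i).rep_of_not_grows v hg, (hc i).free_of_not_grows v hg]
      exact ih

lemma card_rootLevels_le (hc : ∀ j, Coarsens (c j) (c (j + 1)) (σ j) m) (v : V) (i : ℕ) :
    (rootLevels c v i).card ≤ 1 := by
  classical
  suffices h : (rootLevels c v i).card + (if (c i).free v = v then 1 else 0) ≤ 1 by omega
  induction i with
  | zero => simp only [rootLevels, Finset.range_zero, Finset.filter_empty, Finset.card_empty]
            split_ifs <;> omega
  | succ i ih =>
    by_cases hg : (c i).Grows (c (i + 1)) v
    · have h1 := (hc i).rep_of_grows v hg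
      have h2 := (hc i).free_of_grows v hg
      have h3 := (hc i).rep_ne_free v hg
      have hcard : (rootLevels c v (i + 1)).card ≤
          (rootLevels c v i).card + (if (c (i + 1)).rep v = v then 1 else 0) := by
        simp only [rootLevels, Finset.range_add_one, Finset.filter_insert, hg, true_and]
        split_ifs
        · exact Finset.card_insert_le _ _
        · simp
      by_cases hf : (c i).free v = v
      · rw [if_pos hf] at ih
        by_cases h5 : (c (i + 1)).rep v = v
        · rw [if_neg fun h => h3 (h5.trans h.symm)]
          rw [if_pos h5] at hcard
          omega
        · rw [if_neg h5] at hcard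
          split_ifs <;> omega
      · rw [if_neg fun h => hf (h1 h)] at hcard
        rw [if_neg fun h => hf (h2 h)]
        omega
    · have hcard : rootLevels c v (i + 1) = rootLevels c v i := by
        simp only [rootLevels, Finset.range_add_one, Finset.filter_insert, hg, false_and,
          if_false]
      rw [hcard, (hc i).free_of_not_grows v hg]
      exact ih

lemma grows_of_rep_ne (hc : ∀ j, Coarsens (c j) (c (j + 1)) (σ j) m) {v : V} {j : ℕ}
    (hv : (c j).rep v = v) (hne : (c (j + 1)).rep v ≠ v) : (c j).Grows (c (j + 1)) v := by
  by_contra hg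
  exact hne (((hc j).rep_of_not_grows v hg).trans hv)

end Marks

section Radii

variable {V : Type} [MetricSpace V] [Fintype V] {c : ℕ → Clustering V} {σ r : ℕ → ℝ} {m : ℕ}

/-- `r` bounds the radii of the clusters of a hierarchy grouped at the scales `σ`. -/
structure RadiusBound (σ r : ℕ → ℝ) : Prop where
  zero : r 0 = 0
  nonneg : ∀ j, 0 ≤ r j
  succ : ∀ j, 4 * σ j + 2 * r j ≤ r (j + 1)

lemma dist_rep_free_le (h0 : c 0 = Clustering.discrete V)
    (hc : ∀ j, Coarsens (c j) (c (j + 1)) (σ j) m) (hr : RadiusBound σ r) (j : ℕ) (p : V) :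
    dist ((c j).rep p) ((c j).free p) ≤ r j := by
  induction j generalizing p with
  | zero => simp [h0, Clustering.discrete, hr.zero]
  | succ j ih => exact ((hc j).dist_free (r j) (hr.nonneg j) ih p).trans (hr.succ j)

lemma dist_rep_succ_le (h0 : c 0 = Clustering.discrete V)
    (hc : ∀ j, Coarsens (c j) (c (j + 1)) (σ j) m) (hr : RadiusBound σ r) (j : ℕ) (p : V) :
    dist ((c j).rep p) ((c (j + 1)).rep p) ≤ 4 * σ j + r j :=
  (hc j).dist_rep (r j) (hr.nonneg j) (dist_rep_free_le h0 hc hr j) p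

lemma dist_rep_le (h0 : c 0 = Clustering.discrete V)
    (hc : ∀ j, Coarsens (c j) (c (j + 1)) (σ j) m) (hr : RadiusBound σ r) (j : ℕ) (p : V) :
    dist p ((c j).rep p) ≤ r j := by
  induction j with
  | zero => simp [h0, Clustering.discrete, hr.zero]
  | succ j ih =>
    linarith [dist_triangle p ((c j).rep p) ((c (j + 1)).rep p), dist_rep_succ_le h0 hc hr j p,
      hr.succ j]

/-- A cluster with a point that is not much farther from another cluster than the scale of level
`j` grows within few levels. -/
lemma exists_mem_growthLevels (h0 : c 0 = Clustering.discrete V)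
    (hc : ∀ j, Coarsens (c j) (c (j + 1)) (σ j) m) (hr : RadiusBound σ r) {p q : V} {j K : ℕ}
    (hne : (c j).rep q ≠ (c j).rep p)
    (hclose : dist p q + 2 * r (j + K) < σ (j + K) / 2) {i : ℕ} (hi : j + K < i) :
    ∃ b ∈ growthLevels c ((c j).rep p) i, j ≤ b ∧ b ≤ j + K := by
  classical
  have key : ∀ k, (∃ b, j ≤ b ∧ b < j + k ∧ (c b).Grows (c (b + 1)) p ∧
      (c b).rep p = (c j).rep p) ∨
      ((c (j + k)).rep p = (c j).rep p ∧ (c (j + k)).rep q ≠ (c (j + k)).rep p) := by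
    intro k
    induction k with
    | zero => exact Or.inr ⟨rfl, hne⟩
    | succ k ih =>
      rcases ih with ⟨b, h1, h2, h3⟩ | ⟨h1, h2⟩
      · exact Or.inl ⟨b, h1, by omega, h3⟩
      · by_cases hg : (c (j + k)).Grows (c (j + k + 1)) p
        · exact Or.inl ⟨j + k, by omega, by omega, hg, h1⟩
        · refine Or.inr ⟨((hc _).rep_of_not_grows p hg).trans h1, fun h => hg ⟨q, h, h2⟩⟩
  have hgrow : ∃ b, j ≤ b ∧ b ≤ j + K ∧ (c b).Grows (c (b + 1)) p ∧
      (c b).rep p = (c j).rep p := by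
    rcases key K with ⟨b, h1, h2, h3⟩ | ⟨h1, h2⟩
    · exact ⟨b, h1, h2.le, h3⟩
    · by_cases hg : (c (j + K)).Grows (c (j + K + 1)) p
      · exact ⟨j + K, by omega, le_rfl, hg, h1⟩
      · have h3 := (hc _).isolated p q hg h2
        have h4 := dist_rep_le h0 hc hr (j + K) p
        have h5 := dist_rep_le h0 hc hr (j + K) q
        rw [dist_comm] at h4
        linarith [dist_triangle4 ((c (j + K)).rep p) p q ((c (j + K)).rep q)]
  obtain ⟨b, hjb, hbK, ⟨w, hw1, hw2⟩, hbp⟩ := hgrow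
  have hrep : (c b).rep ((c j).rep p) = (c b).rep p := by rw [← hbp, (c b).rep_rep]
  refine ⟨b, ?_, hjb, hbK⟩
  refine Finset.mem_filter.mpr ⟨Finset.mem_range.mpr (by omega), by rw [hrep, hbp], w, ?_, ?_⟩
  · rw [hw1, (hc b).rep_congr _ _ hrep]
  · rwa [hrep]

/-- The number of clusters decreases geometrically. -/
lemma card_reps_le
    (hc : ∀ j, Coarsens (c j) (c (j + 1)) (σ j) m) {M ρ : ℝ} {ℓ : ℕ} (hσ : ∀ j, 0 < σ j)
    (hσs : ∀ j, σ (j + 1) = ρ * σ j) (hσM : ∀ j < ℓ, σ j ≤ M) (hρ : 1 ≤ ρ) (hm : 2 * ρ ≤ m)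
    (hn : (Fintype.card V : ℝ) * σ 0 ≤ M)
    (hsep : ∀ s > 0, ∀ S : Finset V, IsSeparatedBy s S → 2 ≤ S.card → S.card * s ≤ 4 * M)
    {j : ℕ} (hj : j ≤ ℓ) : ((c j).reps.card : ℝ) * σ j ≤ 8 * ρ * M := by
  classical
  have hM : 0 ≤ M := le_trans (mul_nonneg (Nat.cast_nonneg _) (hσ 0).le) hn
  induction j with
  | zero =>
    have h1 : ((c 0).reps.card : ℝ) ≤ Fintype.card V := by
      exact_mod_cast Finset.card_le_univ _
    nlinarith [hσ 0, mul_le_mul_of_nonneg_right h1 (hσ 0).le]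
  | succ j ih =>
    obtain ⟨S, hS, hcard⟩ := (hc j).card_reps
    have hSM : (S.card : ℝ) * σ j ≤ 4 * M := by
      by_cases h2 : 2 ≤ S.card
      · exact hsep _ (hσ j) S hS h2
      · have h1 : (S.card : ℝ) ≤ 1 := by exact_mod_cast (by omega : S.card ≤ 1)
        have := hσM j (by omega)
        nlinarith [hσ j]
    have hcard' : (m : ℝ) * (c (j + 1)).reps.card ≤ m * S.card + (c j).reps.card := by
      exact_mod_cast hcard
    have ih' := ih (by omega)
    have hm0 : (0 : ℝ) < m := by linarith
    have h3 : (m : ℝ) * ((c (j + 1)).reps.card * σ j) ≤ m * (8 * M) := by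
      calc (m : ℝ) * ((c (j + 1)).reps.card * σ j)
          = (m * (c (j + 1)).reps.card) * σ j := by ring
        _ ≤ (m * S.card + (c j).reps.card) * σ j :=
            mul_le_mul_of_nonneg_right hcard' (hσ j).le
        _ = m * (S.card * σ j) + (c j).reps.card * σ j := by ring
        _ ≤ m * (4 * M) + 8 * ρ * M := add_le_add (mul_le_mul_of_nonneg_left hSM hm0.le) ih'
        _ ≤ m * (8 * M) := by nlinarith
    have h4 := le_of_mul_le_mul_left h3 hm0
    rw [hσs]
    nlinarith

end Radii

section Graphs

variable {V : Type} [MetricSpace V]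

lemma edgeWeight_mk (p q : V) : edgeWeight s(p, q) = dist p q := rfl

lemma edgeWeight_nonneg (e : Sym2 V) : 0 ≤ edgeWeight e := by
  induction e with
  | _ p q => exact dist_nonneg

lemma totalWeight_le_card_mul {H : Finset (Sym2 V)} {w : ℝ} (hw : ∀ e ∈ H, edgeWeight e ≤ w) :
    totalWeight H ≤ H.card * w := by
  simpa [totalWeight, nsmul_eq_mul] using Finset.sum_le_card_nsmul H edgeWeight w hw

lemma totalWeight_union_le [DecidableEq (Sym2 V)] (A B : Finset (Sym2 V)) :
    totalWeight (A ∪ B) ≤ totalWeight A + totalWeight B := by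
  have := Finset.sum_union_inter (s₁ := A) (s₂ := B) (f := edgeWeight)
  have h0 : 0 ≤ ∑ e ∈ A ∩ B, edgeWeight e := Finset.sum_nonneg fun e _ => edgeWeight_nonneg e
  simp only [totalWeight]
  linarith

lemma totalWeight_biUnion_le [DecidableEq (Sym2 V)] {ι : Type} (s : Finset ι)
    (H : ι → Finset (Sym2 V)) : totalWeight (s.biUnion H) ≤ ∑ i ∈ s, totalWeight (H i) := by
  classical
  induction s using Finset.induction_on with
  | empty => simp [totalWeight]
  | insert a s ha ih =>
    rw [Finset.biUnion_insert, Finset.sum_insert ha]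
    linarith [totalWeight_union_le (H a) (s.biUnion H)]

lemma degree_union_le {V : Type} [DecidableEq (Sym2 V)] (A B : Finset (Sym2 V)) (p : V) :
    degree (A ∪ B) p ≤ degree A p + degree B p := by
  classical
  simp only [degree, Finset.filter_union]
  convert Finset.card_union_le _ _

lemma degree_biUnion_le {V : Type} [DecidableEq (Sym2 V)] {ι : Type} (s : Finset ι)
    (H : ι → Finset (Sym2 V)) (p : V) : degree (s.biUnion H) p ≤ ∑ i ∈ s, degree (H i) p := by
  classical
  simp only [degree, Finset.filter_biUnion]
  convert Finset.card_biUnion_le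

/-- There is a walk of `H` from `p` to `q` with `k` edges and length `w`. -/
inductive HasWalk (H : Finset (Sym2 V)) : ℕ → ℝ → V → V → Prop
  | refl (p : V) : HasWalk H 0 0 p p
  | cons {p q r : V} {k : ℕ} {w : ℝ} (hpq : s(p, q) ∈ H) (hqr : HasWalk H k w q r) :
      HasWalk H (k + 1) (dist p q + w) p r

namespace HasWalk

variable {H H' : Finset (Sym2 V)} {k k' : ℕ} {w w' : ℝ} {p q r : V}

lemma trans (h : HasWalk H k w p q) (h' : HasWalk H k' w' q r) :
    HasWalk H (k + k') (w + w') p r := by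
  induction h with
  | refl p => simpa using h'
  | cons hpq _ ih =>
    have := cons hpq (ih h')
    rwa [← add_assoc, add_right_comm] at this

lemma symm (h : HasWalk H k w p q) : HasWalk H k w q p := by
  induction h with
  | refl p => exact refl p
  | @cons p q r k w hpq _ ih =>
    have h1 : HasWalk H 1 (dist q p + 0) q p := cons (by rwa [Sym2.eq_swap]) (refl p)
    have := ih.trans h1
    rwa [add_zero, add_comm w, dist_comm q p] at this

lemma mono (hH : H ⊆ H') (h : HasWalk H k w p q) : HasWalk H' k w p q := by
  induction h with
  | refl p => exact refl p
  | cons hpq _ ih => exact cons (hH hpq) ih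

lemma length_nonneg (h : HasWalk H k w p q) : 0 ≤ w := by
  induction h with
  | refl => exact le_rfl
  | cons _ _ ih => exact add_nonneg dist_nonneg ih

open Classical in
lemma filter_edgeWeight {W : ℝ} (h : HasWalk H k w p q) (hw : w ≤ W) :
    HasWalk (H.filter (fun e => edgeWeight e ≤ W)) k w p q := by
  induction h with
  | refl p => exact refl p
  | @cons p q r k w hpq hqr ih =>
    have h1 := hqr.length_nonneg
    have h2 : 0 ≤ dist p q := dist_nonneg
    refine cons (Finset.mem_filter.mpr ⟨hpq, ?_⟩) (ih ?_)
    · rw [edgeWeight_mk]; linarith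
    · linarith

lemma exists_fun (h : HasWalk H k w p q) : ∃ x : Fin (k + 1) → V, x 0 = p ∧ x (Fin.last k) = q ∧
    (∀ i : Fin k, s(x i.castSucc, x i.succ) ∈ H) ∧
    ∑ i : Fin k, dist (x i.castSucc) (x i.succ) = w := by
  induction h with
  | refl p => exact ⟨fun _ => p, rfl, rfl, fun i => i.elim0, by simp⟩
  | @cons p q r k w hpq _ ih =>
    obtain ⟨x, hx0, hxl, hxe, hxs⟩ := ih
    refine ⟨Fin.cons p x, by simp, ?_, ?_, ?_⟩
    · rw [← Fin.succ_last, Fin.cons_succ, hxl]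
    · intro i
      refine Fin.cases ?_ (fun i => ?_) i
      · simpa [hx0] using hpq
      · simpa [← Fin.succ_castSucc] using hxe i
    · rw [Fin.sum_univ_succ]
      simp [hx0, hxs]

lemma of_fun (x : Fin (k + 1) → V) (hx : ∀ i : Fin k, s(x i.castSucc, x i.succ) ∈ H) :
    HasWalk H k (∑ i : Fin k, dist (x i.castSucc) (x i.succ)) (x 0) (x (Fin.last k)) := by
  induction k with
  | zero => simpa using refl (x 0)
  | succ k ih =>
    rw [Fin.sum_univ_succ]
    refine cons (by simpa using hx 0) ?_
    exact ih (fun i => x i.succ) fun i => hx i.succ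

lemma isSpannerPath {t : ℝ} (h : HasWalk H k w p q) (hw : w ≤ t * dist p q) :
    IsSpannerPath H t p q k := by
  obtain ⟨x, h1, h2, h3, h4⟩ := h.exists_fun
  exact ⟨x, h1, h2, h3, h4.trans_le hw⟩

end HasWalk

/-- The connectivity of `T`, in terms of `SimpleGraph`. -/
lemma IsConnectedOn.preconnected {V : Type} {T : Finset (Sym2 V)} (hT : IsConnectedOn T) :
    (SimpleGraph.fromEdgeSet (T : Set (Sym2 V))).Preconnected := by
  intro p q
  obtain ⟨k, x, rfl, rfl, hx⟩ := hT p q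
  have key : ∀ i : ℕ, ∀ hi : i < k + 1,
      (SimpleGraph.fromEdgeSet (T : Set (Sym2 V))).Reachable (x 0) (x ⟨i, hi⟩) := by
    intro i
    induction i with
    | zero => exact fun _ => SimpleGraph.Reachable.refl _
    | succ i ih =>
      intro hi
      refine (ih (by omega)).trans ?_
      have he := hx ⟨i, by omega⟩
      by_cases heq : x ⟨i, by omega⟩ = x ⟨i + 1, hi⟩
      · rw [heq]
      · refine SimpleGraph.Adj.reachable ?_
        rw [SimpleGraph.fromEdgeSet_adj]
        exact ⟨he, heq⟩
  exact key k (by omega)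

/-- A function varies along the edges of a connected graph at least as much as between any two
points. -/
lemma IsConnectedOn.abs_sub_le_sum {V : Type} {T : Finset (Sym2 V)} (hT : IsConnectedOn T)
    (f : V → ℝ) (φ : Sym2 V → ℝ) (hφ0 : ∀ e, 0 ≤ φ e) (hφ : ∀ p q, |f p - f q| ≤ φ s(p, q))
    (p q : V) : |f p - f q| ≤ ∑ e ∈ T, φ e := by
  classical
  obtain ⟨P⟩ := hT.preconnected p q
  have hwalk : ∀ {a b : V} (W : (SimpleGraph.fromEdgeSet (T : Set (Sym2 V))).Walk a b),
      |f a - f b| ≤ (W.edges.map φ).sum := by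
    intro a b W
    induction W with
    | nil => simp
    | cons h W ih =>
      simp only [SimpleGraph.Walk.edges_cons, List.map_cons, List.sum_cons]
      exact (abs_sub_le _ _ _).trans (add_le_add (hφ _ _) ih)
  refine (hwalk P.toPath.1).trans ?_
  have hnd : (P.toPath.1).edges.Nodup := P.toPath.2.edges_nodup
  rw [← List.sum_toFinset _ hnd]
  refine Finset.sum_le_sum_of_subset_of_nonneg (fun e he => ?_) fun e _ _ => hφ0 e
  have := (P.toPath.1).edges_subset_edgeSet (List.mem_toFinset.mp he)
  rw [SimpleGraph.edgeSet_fromEdgeSet] at this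
  exact this.1

lemma IsConnectedOn.dist_le {T : Finset (Sym2 V)} (hT : IsConnectedOn T) (p q : V) :
    dist p q ≤ totalWeight T := by
  have := hT.abs_sub_le_sum (fun x => dist x q) edgeWeight edgeWeight_nonneg
    (fun a b => abs_dist_sub_le a b q) p q
  simpa [totalWeight] using this

lemma IsConnectedOn.card_mul_le {T : Finset (Sym2 V)} (hT : IsConnectedOn T) {s : ℝ}
    (hs : 0 < s) {S : Finset V} (hS : IsSeparatedBy s S) (h2 : 2 ≤ S.card) :
    S.card * s ≤ 4 * totalWeight T := by
  classical
  let f : V → V → ℝ := fun x p => max 0 (s / 2 - dist p x)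
  have hf0 : ∀ x p, s / 2 ≤ dist p x → f x p = 0 := fun x p h => max_eq_left (by linarith)
  have hfd : ∀ x p q, |f x p - f x q| ≤ dist p q := by
    intro x p q
    have h1 : |f x p - f x q| ≤ |s / 2 - dist p x - (s / 2 - dist q x)| := by
      simpa only [f, max_comm (0 : ℝ)] using abs_max_sub_max_le_abs _ _ (0 : ℝ)
    rw [show s / 2 - dist p x - (s / 2 - dist q x) = dist q x - dist p x by ring] at h1
    rw [dist_comm p q]
    exact h1.trans (abs_dist_sub_le q p x)
  let φ : V → Sym2 V → ℝ := fun x e =>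
    Sym2.lift ⟨fun p q => |f x p - f x q|, fun p q => abs_sub_comm _ _⟩ e
  have hφ0 : ∀ x e, 0 ≤ φ x e := fun x e => by
    induction e with
    | _ p q => exact abs_nonneg _
  have hx : ∀ x ∈ S, s / 2 ≤ ∑ e ∈ T, φ x e := by
    intro x hx
    obtain ⟨y, hy, hyx⟩ := Finset.exists_mem_ne (by omega : 1 < S.card) x
    have h1 := hT.abs_sub_le_sum (f x) (φ x) (hφ0 x) (fun _ _ => le_rfl) x y
    have h3 := hS y hy x hx hyx
    rw [hf0 x y (by linarith)] at h1
    have h4 : f x x = s / 2 := by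
      simp only [f, dist_self, sub_zero]
      exact max_eq_right (by linarith)
    rw [h4, sub_zero, abs_of_pos (by linarith)] at h1
    exact h1
  have hunique : ∀ p, (S.filter (fun x => dist p x < s / 2)).card ≤ 1 := by
    intro p
    rw [Finset.card_le_one]
    intro a ha b hb
    rw [Finset.mem_filter] at ha hb
    by_contra hab
    have := hS a ha.1 b hb.1 hab
    linarith [dist_triangle_left a b p]
  have he : ∀ e ∈ T, ∑ x ∈ S, φ x e ≤ 2 * edgeWeight e := by
    intro e _
    induction e with
    | _ p q =>
    rw [edgeWeight_mk]
    have h1 : ∑ x ∈ S, φ x s(p, q) ≤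
        ∑ x ∈ S, ((if dist p x < s / 2 then dist p q else 0) +
          (if dist q x < s / 2 then dist p q else 0)) := by
      refine Finset.sum_le_sum fun x _ => ?_
      change |f x p - f x q| ≤ _
      have := hfd x p q
      have h0 : 0 ≤ dist p q := dist_nonneg
      split_ifs with ha hb
      · linarith
      · linarith
      · linarith
      · rw [hf0 x p (by linarith), hf0 x q (by linarith)]
        simp
    refine h1.trans ?_
    rw [Finset.sum_add_distrib, ← Finset.sum_filter, ← Finset.sum_filter, Finset.sum_const,
      Finset.sum_const, nsmul_eq_mul, nsmul_eq_mul]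
    have c1 : ((S.filter (fun x => dist p x < s / 2)).card : ℝ) ≤ 1 := by exact_mod_cast hunique p
    have c2 : ((S.filter (fun x => dist q x < s / 2)).card : ℝ) ≤ 1 := by exact_mod_cast hunique q
    nlinarith [@dist_nonneg _ _ p q]
  have h5 : (S.card : ℝ) * (s / 2) ≤ 2 * totalWeight T := by
    calc (S.card : ℝ) * (s / 2) = ∑ _x ∈ S, s / 2 := by rw [Finset.sum_const, nsmul_eq_mul]
      _ ≤ ∑ x ∈ S, ∑ e ∈ T, φ x e := Finset.sum_le_sum hx
      _ = ∑ e ∈ T, ∑ x ∈ S, φ x e := Finset.sum_comm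
      _ ≤ ∑ e ∈ T, 2 * edgeWeight e := Finset.sum_le_sum he
      _ = 2 * totalWeight T := by rw [totalWeight, Finset.mul_sum]
  linarith

/-- A star is a connected graph with one edge less than points. -/
lemma exists_spanning_star (V : Type) [Fintype V] [Nonempty V] :
    ∃ T : Finset (Sym2 V), IsGraphOn T ∧ IsConnectedOn T ∧ T.card = Fintype.card V - 1 := by
  classical
  obtain ⟨o⟩ := ‹Nonempty V›
  refine ⟨(Finset.univ.erase o).image (fun v => s(o, v)), ?_, ?_, ?_⟩
  · intro e he
    obtain ⟨v, hv, rfl⟩ := Finset.mem_image.mp he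
    simpa [eq_comm] using hv
  · have hmem : ∀ v, v ≠ o → s(o, v) ∈ (Finset.univ.erase o).image (fun v => s(o, v)) :=
      fun v hv => Finset.mem_image_of_mem _ (by simpa using hv)
    intro p q
    by_cases hp : p = o
    · by_cases hq : q = o
      · exact ⟨0, fun _ => p, rfl, hp.trans hq.symm, fun i => i.elim0⟩
      · refine ⟨1, ![o, q], hp.symm, rfl, fun i => ?_⟩
        fin_cases i
        exact hmem q hq
    · by_cases hq : q = o
      · refine ⟨1, ![p, o], rfl, hq.symm, fun i => ?_⟩
        fin_cases i
        rw [Sym2.eq_swap]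
        exact hmem p hp
      · refine ⟨2, ![p, o, q], rfl, rfl, fun i => ?_⟩
        fin_cases i
        · rw [Sym2.eq_swap]
          exact hmem p hp
        · exact hmem q hq
  · rw [Finset.card_image_of_injective _ fun a b h => Sym2.congr_right.mp h,
      Finset.card_erase_of_mem (Finset.mem_univ _), Finset.card_univ]

lemma le_mstWeight [Fintype V] [Nonempty V] {a : ℝ}
    (h : ∀ T : Finset (Sym2 V), IsConnectedOn T → a ≤ totalWeight T) : a ≤ mstWeight V := by
  refine le_csInf ?_ ?_
  · obtain ⟨T, h1, h2, h3⟩ := exists_spanning_star V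
    exact ⟨_, T, h1, h2, h3, rfl⟩
  · rintro _ ⟨T, -, hT, -, rfl⟩
    exact h T hT

lemma IsSpanner.isConnectedOn {H : Finset (Sym2 V)} {t : ℝ} (hH : IsSpanner H t) :
    IsConnectedOn H := fun p q =>
  let ⟨k, x, h1, h2, h3, _⟩ := hH p q
  ⟨k, x, h1, h2, h3⟩

lemma IsConnectedOn.card_le {V : Type} [Fintype V] [Nonempty V] {T : Finset (Sym2 V)}
    (hT : IsConnectedOn T) : Fintype.card V ≤ T.card + 1 := by
  classical
  have hconn : (SimpleGraph.fromEdgeSet (T : Set (Sym2 V))).Connected :=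
    SimpleGraph.connected_iff _ |>.mpr ⟨hT.preconnected, inferInstance⟩
  have h1 := hconn.card_vert_le_card_edgeSet_add_one
  have h2 : Nat.card (SimpleGraph.fromEdgeSet (T : Set (Sym2 V))).edgeSet ≤ T.card := by
    rw [SimpleGraph.edgeSet_fromEdgeSet, Nat.card_coe_set_eq]
    exact (Set.ncard_le_ncard Set.sdiff_subset T.finite_toSet).trans_eq (Set.ncard_coe_finset T)
  rw [Nat.card_eq_fintype_card] at h1
  omega

end Graphs

section Tree

variable {V : Type} [Fintype V] {c : ℕ → Clustering V} {σ r : ℕ → ℝ} {m : ℕ}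

open Classical in
/-- The edges that join the representatives of level `j` to their successors in level `j + 1`. -/
noncomputable def levelEdges (c : ℕ → Clustering V) (j : ℕ) : Finset (Sym2 V) :=
  ((c j).reps.image (fun v => s(v, (c (j + 1)).rep v))).filter (fun e => ¬ e.IsDiag)

open Classical in
/-- The edges that join the representatives of consecutive levels, below level `ℓ`. -/
noncomputable def treeEdges (c : ℕ → Clustering V) (ℓ : ℕ) : Finset (Sym2 V) :=
  (Finset.range ℓ).biUnion (levelEdges c)

lemma mem_treeEdges {ℓ : ℕ} {e : Sym2 V} : e ∈ treeEdges c ℓ ↔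
    ∃ j < ℓ, ∃ v, (c j).rep v = v ∧ (c (j + 1)).rep v ≠ v ∧ e = s(v, (c (j + 1)).rep v) := by
  classical
  simp only [treeEdges, levelEdges, Finset.mem_biUnion, Finset.mem_range, Finset.mem_filter,
    Finset.mem_image, Clustering.mem_reps]
  constructor
  · rintro ⟨j, hj, ⟨v, hv, rfl⟩, hd⟩
    exact ⟨j, hj, v, hv, fun h => hd h.symm, rfl⟩
  · rintro ⟨j, hj, v, hv, hne, rfl⟩
    exact ⟨j, hj, ⟨v, hv, rfl⟩, fun h => hne h.symm⟩

lemma isGraphOn_treeEdges (ℓ : ℕ) : IsGraphOn (treeEdges c ℓ) := by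
  intro e he
  obtain ⟨j, -, v, -, hne, rfl⟩ := mem_treeEdges.mp he
  exact fun h => hne h.symm

variable [MetricSpace V]

lemma mem_growthLevels_of_ne (hc : ∀ j, Coarsens (c j) (c (j + 1)) (σ j) m) {v : V} {j ℓ : ℕ}
    (hj : j < ℓ) (hv : (c j).rep v = v) (hne : (c (j + 1)).rep v ≠ v) :
    j ∈ growthLevels c v ℓ := by
  classical
  exact Finset.mem_filter.mpr ⟨Finset.mem_range.mpr hj, hv, grows_of_rep_ne hc hv hne⟩

lemma card_treeEdges_le (hc : ∀ j, Coarsens (c j) (c (j + 1)) (σ j) m) (ℓ : ℕ) :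
    (treeEdges c ℓ).card ≤ 2 * Fintype.card V := by
  classical
  have hsub : treeEdges c ℓ ⊆ (Finset.univ : Finset V).biUnion
      (fun v => (growthLevels c v ℓ).image (fun b => s(v, (c (b + 1)).rep v))) := by
    intro e he
    obtain ⟨j, hj, v, hv, hne, rfl⟩ := mem_treeEdges.mp he
    exact Finset.mem_biUnion.mpr ⟨v, Finset.mem_univ _,
      Finset.mem_image_of_mem (fun b => s(v, (c (b + 1)).rep v))
        (mem_growthLevels_of_ne hc hj hv hne)⟩
  refine (Finset.card_le_card hsub).trans ?_
  rw [mul_comm]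
  exact Finset.card_biUnion_le_card_mul _ _ _ fun v _ =>
    Finset.card_image_le.trans (card_growthLevels_le hc v ℓ)

lemma degree_treeEdges_le (hc : ∀ j, Coarsens (c j) (c (j + 1)) (σ j) m) (ℓ : ℕ) (v : V) :
    degree (treeEdges c ℓ) v ≤ 2 + 2 * m := by
  classical
  have hsub : (treeEdges c ℓ).filter (fun e => v ∈ e) ⊆
      (growthLevels c v ℓ).image (fun b => s(v, (c (b + 1)).rep v)) ∪
      (rootLevels c v ℓ).biUnion (fun b =>
        ((c b).reps.filter (fun z => (c (b + 1)).rep z = (c (b + 1)).rep v)).image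
          (fun z => s(z, v))) := by
    intro e he
    rw [Finset.mem_filter] at he
    obtain ⟨j, hj, z, hz, hne, rfl⟩ := mem_treeEdges.mp he.1
    rcases Sym2.mem_iff.mp he.2 with rfl | rfl
    · exact Finset.mem_union_left _ (Finset.mem_image_of_mem
        (fun b => s(v, (c (b + 1)).rep v)) (mem_growthLevels_of_ne hc hj hz hne))
    · have hroot : (c (j + 1)).rep ((c (j + 1)).rep z) = (c (j + 1)).rep z := (c (j + 1)).rep_rep z
      refine Finset.mem_union_right _ (Finset.mem_biUnion.mpr ⟨j, ?_, ?_⟩)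
      · refine Finset.mem_filter.mpr ⟨Finset.mem_range.mpr hj, ?_, hroot⟩
        by_contra hg
        have h1 := (hc j).rep_of_not_grows _ hg
        refine hg ⟨z, hroot.symm, fun h => hne ?_⟩
        rw [← hroot, h1, ← h, hz]
      · exact Finset.mem_image.mpr ⟨z, Finset.mem_filter.mpr
          ⟨Clustering.mem_reps.mpr hz, hroot.symm⟩, rfl⟩
  have h1 : ((growthLevels c v ℓ).image (fun b => s(v, (c (b + 1)).rep v))).card ≤ 2 :=
    Finset.card_image_le.trans (card_growthLevels_le hc v ℓ)
  have h2 : ((rootLevels c v ℓ).biUnion (fun b =>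
        ((c b).reps.filter (fun z => (c (b + 1)).rep z = (c (b + 1)).rep v)).image
          (fun z => s(z, v)))).card ≤ (rootLevels c v ℓ).card * (2 * m) :=
    Finset.card_biUnion_le_card_mul _ _ _ fun b _ =>
      Finset.card_image_le.trans ((hc b).card_children v)
  have h3 := Nat.mul_le_mul_right (2 * m) (card_rootLevels_le hc v ℓ)
  have h4 := (Finset.card_le_card hsub).trans (Finset.card_union_le _ _)
  have h5 : degree (treeEdges c ℓ) v = ((treeEdges c ℓ).filter (fun e => v ∈ e)).card := by
    unfold degree
    congr
  omega

lemma totalWeight_treeEdges_le (h0 : c 0 = Clustering.discrete V)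
    (hc : ∀ j, Coarsens (c j) (c (j + 1)) (σ j) m) (hr : RadiusBound σ r) (hσ : ∀ j, 0 < σ j)
    (ℓ : ℕ) :
    totalWeight (treeEdges c ℓ) ≤
      ∑ j ∈ Finset.range ℓ, ((c j).reps.card : ℝ) * (4 * σ j + r j) := by
  classical
  refine (totalWeight_biUnion_le _ _).trans (Finset.sum_le_sum fun j _ => ?_)
  have hw : ∀ e ∈ levelEdges c j, edgeWeight e ≤ 4 * σ j + r j := by
    intro e he
    obtain ⟨v, hv, rfl⟩ := Finset.mem_image.mp (Finset.mem_filter.mp he).1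
    have := dist_rep_succ_le h0 hc hr j v
    rwa [Clustering.mem_reps.mp hv] at this
  refine (totalWeight_le_card_mul hw).trans (mul_le_mul_of_nonneg_right ?_ ?_)
  · exact_mod_cast (Finset.card_filter_le _ _).trans Finset.card_image_le
  · linarith [hσ j, hr.nonneg j]

lemma exists_walk_treeEdges (h0 : c 0 = Clustering.discrete V)
    (hc : ∀ j, Coarsens (c j) (c (j + 1)) (σ j) m) (hr : RadiusBound σ r) (hσ : ∀ j, 0 < σ j)
    {ℓ j : ℕ} (hj : j ≤ ℓ) (p : V) :
    ∃ k ≤ j, ∃ w ≤ r j, HasWalk (treeEdges c ℓ) k w p ((c j).rep p) := by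
  induction j with
  | zero =>
    refine ⟨0, le_rfl, 0, hr.zero.ge, ?_⟩
    rw [h0]
    exact HasWalk.refl p
  | succ j ih =>
    obtain ⟨k, hk, w, hw, hwalk⟩ := ih (by omega)
    have hsucc := hr.succ j
    have hcongr : (c (j + 1)).rep ((c j).rep p) = (c (j + 1)).rep p :=
      (hc j).rep_congr _ _ ((c j).rep_rep p)
    by_cases heq : (c (j + 1)).rep p = (c j).rep p
    · exact ⟨k, by omega, w, by linarith [hσ j, hr.nonneg j], heq ▸ hwalk⟩
    · have hedge : s((c j).rep p, (c (j + 1)).rep p) ∈ treeEdges c ℓ :=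
        mem_treeEdges.mpr ⟨j, by omega, (c j).rep p, (c j).rep_rep p, hcongr ▸ heq, by rw [hcongr]⟩
      refine ⟨k + 1, by omega, _, ?_, hwalk.trans (HasWalk.cons hedge (HasWalk.refl _))⟩
      linarith [dist_rep_succ_le h0 hc hr j p]

end Tree

section Active

variable {V : Type} [MetricSpace V] {c : ℕ → Clustering V} {σ r D : ℕ → ℝ} {m : ℕ}

/-- `j` is the first level whose distance threshold is at least the distance of the distinct
points `p` and `q`. -/
def IsActivePair (D : ℕ → ℝ) (j : ℕ) (p q : V) : Prop :=
  p ≠ q ∧ dist p q ≤ D j ∧ ∀ i < j, D i < dist p q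

lemma IsActivePair.symm {j : ℕ} {p q : V} (h : IsActivePair D j p q) : IsActivePair D j q p := by
  obtain ⟨h1, h2, h3⟩ := h
  rw [dist_comm] at h2
  exact ⟨h1.symm, h2, fun i hi => by rw [dist_comm]; exact h3 i hi⟩

lemma exists_isActivePair {ℓ : ℕ} {p q : V} (hpq : p ≠ q) (hℓ : dist p q ≤ D ℓ) :
    ∃ j ≤ ℓ, IsActivePair D j p q := by
  classical
  have hex : ∃ j, dist p q ≤ D j := ⟨ℓ, hℓ⟩
  exact ⟨Nat.find hex, Nat.find_min' hex hℓ, hpq, Nat.find_spec hex,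
    fun i hi => not_le.mp (Nat.find_min hex hi)⟩

variable [Fintype V]

open Classical in
/-- The representatives of the clusters of level `j` that meet an active pair of level `j`. -/
noncomputable def activeReps (c : ℕ → Clustering V) (D : ℕ → ℝ) (j : ℕ) : Finset V :=
  (Finset.univ.filter (fun p => ∃ q, IsActivePair D j p q)).image (c j).rep

lemma activeReps_subset (j : ℕ) : activeReps c D j ⊆ (c j).reps := by
  classical
  intro v hv
  obtain ⟨p, -, rfl⟩ := Finset.mem_image.mp hv
  exact (c j).rep_mem_reps p

lemma IsActivePair.rep_mem {j : ℕ} {p q : V} (h : IsActivePair D j p q) :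
    (c j).rep p ∈ activeReps c D j := by
  classical
  exact Finset.mem_image_of_mem _ (Finset.mem_filter.mpr ⟨Finset.mem_univ _, q, h⟩)

open Classical in
lemma card_active_levels_le (h0 : c 0 = Clustering.discrete V)
    (hc : ∀ j, Coarsens (c j) (c (j + 1)) (σ j) m) (hr : RadiusBound σ r) {K : ℕ}
    (hfar : ∀ j p q, IsActivePair D j p q → (c j).rep q ≠ (c j).rep p)
    (hclose : ∀ j, D j + 2 * r (j + K) < σ (j + K) / 2) (L : ℕ) (v : V) :
    ((Finset.range L).filter (fun j => v ∈ activeReps c D j)).card ≤ 2 * (K + 1) := by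
  have hsub : (Finset.range L).filter (fun j => v ∈ activeReps c D j) ⊆
      (growthLevels c v (L + K)).biUnion (fun b => Finset.Icc (b - K) b) := by
    intro j hj
    obtain ⟨hjL, hv⟩ := Finset.mem_filter.mp hj
    obtain ⟨p, hp, rfl⟩ := Finset.mem_image.mp hv
    obtain ⟨q, hpq⟩ := (Finset.mem_filter.mp hp).2
    rw [Finset.mem_range] at hjL
    obtain ⟨b, hb, hjb, hbK⟩ := exists_mem_growthLevels h0 hc hr (hfar j p q hpq)
      (by linarith [hclose j, hpq.2.1] : dist p q + 2 * r (j + K) < σ (j + K) / 2)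
      (by omega : j + K < L + K)
    exact Finset.mem_biUnion.mpr ⟨b, hb, Finset.mem_Icc.mpr ⟨by omega, hjb⟩⟩
  refine (Finset.card_le_card hsub).trans ?_
  refine (Finset.card_biUnion_le_card_mul _ _ (K + 1) fun b _ => ?_).trans
    (Nat.mul_le_mul_right _ (card_growthLevels_le hc v _))
  rw [Nat.card_Icc]
  omega

end Active

section LevelSpanners

variable {V : Type} {R : ℕ → Finset V} {H : ℕ → Finset (Sym2 V)} {L N : ℕ}

open Classical in
lemma degree_biUnion_levels_le {v : V}
    (hN : ((Finset.range L).filter (fun j => v ∈ R j)).card ≤ N) {Δ : ℝ} (hΔ : 0 ≤ Δ)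
    (hR : ∀ j, ∀ e ∈ H j, ∀ u ∈ e, u ∈ R j) (hH : ∀ j, (degree (H j) v : ℝ) ≤ Δ) :
    (degree ((Finset.range L).biUnion H) v : ℝ) ≤ N * Δ := by
  have h0 : ∀ j, v ∉ R j → degree (H j) v = 0 := by
    intro j hj
    unfold degree
    rw [Finset.card_eq_zero, Finset.filter_eq_empty_iff]
    exact fun e he hv => hj (hR j e he v hv)
  calc (degree ((Finset.range L).biUnion H) v : ℝ)
      ≤ ∑ j ∈ Finset.range L, (degree (H j) v : ℝ) := by exact_mod_cast degree_biUnion_le _ _ _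
    _ = ∑ j ∈ (Finset.range L).filter (fun j => v ∈ R j), (degree (H j) v : ℝ) := by
      refine (Finset.sum_filter_of_ne fun j _ hne => ?_).symm
      by_contra hj
      exact hne (by rw [h0 j hj, Nat.cast_zero])
    _ ≤ ((Finset.range L).filter (fun j => v ∈ R j)).card * Δ := by
      rw [← nsmul_eq_mul]
      exact Finset.sum_le_card_nsmul _ _ _ fun j _ => hH j
    _ ≤ N * Δ := by gcongr

variable [Fintype V]

open Classical in
lemma sum_card_le (hN : ∀ v, ((Finset.range L).filter (fun j => v ∈ R j)).card ≤ N) :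
    ∑ j ∈ Finset.range L, (R j).card ≤ N * Fintype.card V := by
  have h1 : ∀ j, (R j).card = ∑ v : V, if v ∈ R j then 1 else 0 := by
    intro j
    simp
  simp_rw [h1]
  rw [Finset.sum_comm, mul_comm, ← smul_eq_mul, ← Finset.card_univ]
  refine Finset.sum_le_card_nsmul _ _ _ fun v _ => ?_
  rw [← Finset.card_filter]
  exact hN v

open Classical in
lemma card_biUnion_levels_le (hN : ∀ v, ((Finset.range L).filter (fun j => v ∈ R j)).card ≤ N)
    {B : ℝ} (hB : 0 ≤ B) (hH : ∀ j, ((H j).card : ℝ) ≤ B * (R j).card) :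
    (((Finset.range L).biUnion H).card : ℝ) ≤ N * B * Fintype.card V := by
  calc (((Finset.range L).biUnion H).card : ℝ)
      ≤ ∑ j ∈ Finset.range L, ((H j).card : ℝ) := by exact_mod_cast Finset.card_biUnion_le
    _ ≤ ∑ j ∈ Finset.range L, B * (R j).card := Finset.sum_le_sum fun j _ => hH j
    _ = B * ((∑ j ∈ Finset.range L, (R j).card : ℕ) : ℝ) := by
      rw [← Finset.mul_sum, Nat.cast_sum]
    _ ≤ B * ((N * Fintype.card V : ℕ) : ℝ) := by
      gcongr
      exact sum_card_le hN
    _ = N * B * Fintype.card V := by push_cast; ring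

end LevelSpanners

section Core

variable {V : Type} [MetricSpace V]

/-- `H` is a `t`-spanner for the points of `R`, with at most `s` edges, degree at most `Δ` and
hop-diameter at most `Λ`. -/
structure IsSpannerOn (R : Finset V) (H : Finset (Sym2 V)) (t s Δ Λ : ℝ) : Prop where
  isGraphOn : IsGraphOn H
  mem_of_mem : ∀ e ∈ H, ∀ v ∈ e, v ∈ R
  card_le : (H.card : ℝ) ≤ s
  degree_le : ∀ v, (degree H v : ℝ) ≤ Δ
  exists_walk : ∀ p ∈ R, ∀ q ∈ R, ∃ k : ℕ, (k : ℝ) ≤ Λ ∧ ∃ w ≤ t * dist p q, HasWalk H k w p q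

/-- The radii of the clusters at the scales `σ`. -/
def clusterRadius (σ : ℕ → ℝ) : ℕ → ℝ
  | 0 => 0
  | j + 1 => 8 * σ j

lemma clusterRadius_le {σ : ℕ → ℝ} {ρ : ℝ} (hσ : ∀ j, 0 < σ j) (hσs : ∀ j, σ (j + 1) = ρ * σ j)
    (hρ : 128 ≤ ρ) (j : ℕ) : clusterRadius σ j ≤ σ j / 16 := by
  cases j with
  | zero => exact div_nonneg (hσ 0).le (by norm_num)
  | succ j =>
    simp only [clusterRadius, hσs]
    nlinarith [hσ j]

lemma radiusBound_clusterRadius {σ : ℕ → ℝ} {ρ : ℝ} (hσ : ∀ j, 0 < σ j)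
    (hσs : ∀ j, σ (j + 1) = ρ * σ j) (hρ : 128 ≤ ρ) : RadiusBound σ (clusterRadius σ) where
  zero := rfl
  nonneg j := by
    cases j with
    | zero => exact le_rfl
    | succ j => exact mul_nonneg (by norm_num) (hσ j).le
  succ j := by
    have := clusterRadius_le hσ hσs hρ j
    rw [show clusterRadius σ (j + 1) = 8 * σ j from rfl]
    linarith [hσ j]

lemma IsActivePair.clusterRadius_le {D : ℕ → ℝ} {δ : ℝ} (hδ : 0 ≤ δ) {j : ℕ} {p q : V}
    (h : IsActivePair D j p q) : clusterRadius (fun i => δ * D i) j ≤ 8 * δ * dist p q := by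
  cases j with
  | zero => exact mul_nonneg (by linarith) dist_nonneg
  | succ j =>
    have := mul_le_mul_of_nonneg_left (h.2.2 j (Nat.lt_succ_self j)).le hδ
    simp only [clusterRadius]
    linarith

/-- A spanner that is both light and sparse, obtained from a supply of spanners for all subsets. -/
theorem exists_light_spanner [Fintype V] {t ε ρ B Δ Λ M : ℝ} {ℓ K : ℕ} (ht : 1 ≤ t) (hε : 0 < ε)
    (hεt : ε ≤ t) (hρ : 128 ≤ ρ) (hM : 0 < M) (hcard : 0 < Fintype.card V)
    (hdiam : ∀ p q : V, dist p q ≤ M)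
    (hsep : ∀ s > 0, ∀ S : Finset V, IsSeparatedBy s S → 2 ≤ S.card → S.card * s ≤ 4 * M)
    (hℓ : (Fintype.card V : ℝ) ≤ ρ ^ ℓ) (hℓ' : ∀ j < ℓ, ρ ^ j ≤ (Fintype.card V : ℝ))
    (hK : 128 * t < ε * ρ ^ K) (hB : 0 ≤ B) (hΔ : 0 ≤ Δ) (hΛ : 0 ≤ Λ)
    (hsupply : ∀ R : Finset V, ∃ H, IsSpannerOn R H t (B * R.card) Δ Λ) :
    ∃ H' : Finset (Sym2 V), IsGraphOn H' ∧
      (H'.card : ℝ) ≤ 2 * Fintype.card V + 2 * (K + 1) * B * Fintype.card V ∧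
      (∀ v, (degree H' v : ℝ) ≤ 2 * (K + 1) * Δ + 4 + 4 * ρ) ∧
      (∀ p q, ∃ k : ℕ, (k : ℝ) ≤ Λ + 2 * ℓ ∧ IsSpannerPath H' (t + ε) p q k) ∧
      totalWeight H' ≤ 40 * ρ * M * ℓ + (ℓ + 1) * (512 * B * ρ * (t ^ 2 / ε) * M) := by
  classical
  have hn : (0 : ℝ) < Fintype.card V := by exact_mod_cast hcard
  set n : ℝ := (Fintype.card V : ℝ)
  obtain ⟨δ, hδt⟩ : ∃ δ : ℝ, δ * (32 * t) = ε := ⟨ε / (32 * t), by field_simp⟩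
  have hδ : 0 < δ := pos_of_mul_pos_left (hδt ▸ hε) (by linarith)
  have hδ1 : δ ≤ 1 / 32 := by
    by_contra! h
    nlinarith
  obtain ⟨D, hDdef⟩ : ∃ D : ℕ → ℝ, ∀ j, D j = ρ ^ j * (M / n) := ⟨_, fun _ => rfl⟩
  have hMn : 0 < M / n := div_pos hM hn
  have hD : ∀ j, 0 < D j := fun j => by rw [hDdef]; positivity
  have hDs : ∀ j, D (j + 1) = ρ * D j := fun j => by rw [hDdef, hDdef, pow_succ]; ring
  have hDM : M ≤ D ℓ := by
    rw [hDdef, ← mul_div_assoc, le_div_iff₀ hn]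
    nlinarith
  obtain ⟨σ, hσD⟩ : ∃ σ : ℕ → ℝ, σ = fun i => δ * D i := ⟨_, rfl⟩
  have hσ : ∀ j, 0 < σ j := fun j => by rw [hσD]; exact mul_pos hδ (hD j)
  have hσs : ∀ j, σ (j + 1) = ρ * σ j := fun j => by simp only [hσD, hDs]; ring
  have hrle := clusterRadius_le hσ hσs hρ
  have hr := radiusBound_clusterRadius hσ hσs hρ
  have hract : ∀ {j : ℕ} {p q : V}, IsActivePair D j p q →
      clusterRadius σ j ≤ 8 * δ * dist p q := fun h => hσD ▸ h.clusterRadius_le hδ.le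
  set r := clusterRadius σ
  have hm2 : 2 ≤ ⌈2 * ρ⌉₊ := by
    have h1 := Nat.le_ceil (2 * ρ)
    have h2 : (2 : ℝ) ≤ ⌈2 * ρ⌉₊ := by linarith
    exact_mod_cast h2
  have hmρ : 2 * (⌈2 * ρ⌉₊ : ℝ) ≤ 2 + 4 * ρ := by
    linarith [Nat.ceil_lt_add_one (by linarith : 0 ≤ 2 * ρ)]
  obtain ⟨c, h0, hc⟩ := exists_hierarchy V hσ hm2
  have hcr : ∀ {j}, j ≤ ℓ → ((c j).reps.card : ℝ) * σ j ≤ 8 * ρ * M := by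
    refine card_reps_le hc hσ hσs (fun j hj => ?_) (by linarith) (Nat.le_ceil _) ?_ hsep
    · have h1 : D j ≤ M := by
        rw [hDdef, ← mul_div_assoc, div_le_iff₀ hn]
        nlinarith [hℓ' j hj]
      rw [hσD]
      nlinarith [hD j]
    · have h1 : n * D 0 = M := by rw [hDdef]; field_simp
      rw [hσD]
      nlinarith
  have hrep : ∀ j p, dist p ((c j).rep p) ≤ r j := fun j p => dist_rep_le h0 hc hr j p
  have hfar : ∀ j p q, IsActivePair D j p q → (c j).rep q ≠ (c j).rep p := by
    intro j p q h heq
    have h1 := hrep j p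
    have h2 := hrep j q
    have h3 := dist_triangle_right p q ((c j).rep p)
    rw [heq] at h2
    have h4 := dist_pos.mpr h.1
    nlinarith [hract h]
  have hclose : ∀ j, D j + 2 * r (j + K) < σ (j + K) / 2 := by
    intro j
    have h1 : σ (j + K) = δ * ρ ^ K * D j := by simp only [hσD, hDdef, pow_add]; ring
    have h2 : 4 < δ * ρ ^ K := by
      by_contra! h
      rw [← hδt] at hK
      nlinarith
    nlinarith [hrle (j + K), hD j]
  have hN := card_active_levels_le h0 hc hr hfar hclose (ℓ + 1)
  choose G hG using fun j => hsupply (activeReps c D j)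
  let H : ℕ → Finset (Sym2 V) := fun j => (G j).filter (fun e => edgeWeight e ≤ 2 * t * D j)
  have hHG : ∀ j, H j ⊆ G j := fun j => Finset.filter_subset _ _
  have hHcard : ∀ j, ((H j).card : ℝ) ≤ B * (activeReps c D j).card := fun j =>
    le_trans (by exact_mod_cast Finset.card_le_card (hHG j)) (hG j).card_le
  have hHdeg : ∀ j v, (degree (H j) v : ℝ) ≤ Δ := fun j v => by
    refine le_trans ?_ ((hG j).degree_le v)
    exact_mod_cast Finset.card_le_card (Finset.filter_subset_filter _ (hHG j))
  refine ⟨treeEdges c ℓ ∪ (Finset.range (ℓ + 1)).biUnion H, ?_, ?_, ?_, ?_, ?_⟩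
  · intro e he
    rcases Finset.mem_union.mp he with he | he
    · exact isGraphOn_treeEdges ℓ e he
    · obtain ⟨j, -, hj⟩ := Finset.mem_biUnion.mp he
      exact (hG j).isGraphOn e (hHG j hj)
  · have h1 := card_biUnion_levels_le hN hB hHcard
    have h2 : ((treeEdges c ℓ).card : ℝ) ≤ 2 * (Fintype.card V : ℝ) := by
      exact_mod_cast card_treeEdges_le hc ℓ
    have h3 : ((treeEdges c ℓ ∪ (Finset.range (ℓ + 1)).biUnion H).card : ℝ) ≤
        (treeEdges c ℓ).card + ((Finset.range (ℓ + 1)).biUnion H).card := by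
      exact_mod_cast Finset.card_union_le _ _
    push_cast at h1
    linarith
  · intro v
    have h1 := degree_biUnion_levels_le (hN v) hΔ
      (fun j e he => (hG j).mem_of_mem e (hHG j he)) (fun j => hHdeg j v)
    have h2 : (degree (treeEdges c ℓ) v : ℝ) ≤ 2 + 2 * (⌈2 * ρ⌉₊ : ℝ) := by
      exact_mod_cast degree_treeEdges_le hc ℓ v
    have h3 : (degree (treeEdges c ℓ ∪ (Finset.range (ℓ + 1)).biUnion H) v : ℝ) ≤
        degree (treeEdges c ℓ) v + degree ((Finset.range (ℓ + 1)).biUnion H) v := by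
      exact_mod_cast degree_union_le _ _ _
    push_cast at h1
    linarith
  · intro p q
    by_cases hpq : p = q
    · subst hpq
      exact ⟨0, by push_cast; positivity, (HasWalk.refl p).isSpannerPath (by simp)⟩
    obtain ⟨j, hj, hact⟩ := exists_isActivePair hpq ((hdiam p q).trans hDM)
    have hd := dist_pos.mpr hpq
    obtain ⟨k₁, hk₁, w₁, hw₁, hwalk₁⟩ := exists_walk_treeEdges h0 hc hr hσ hj p
    obtain ⟨k₂, hk₂, w₂, hw₂, hwalk₂⟩ := exists_walk_treeEdges h0 hc hr hσ hj q
    obtain ⟨k, hk, w, hw, hwalk⟩ :=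
      (hG j).exists_walk _ hact.rep_mem _ hact.symm.rep_mem
    have hdd : dist ((c j).rep p) ((c j).rep q) ≤ dist p q + 2 * r j := by
      have h1 := dist_triangle4 ((c j).rep p) p q ((c j).rep q)
      have h2 := hrep j p
      have h3 := hrep j q
      rw [dist_comm] at h2
      linarith
    have hra := hract hact
    have hra' : 4 * t * r j ≤ ε * dist p q := by
      have : 4 * t * r j ≤ 4 * t * (8 * δ * dist p q) := by gcongr
      rw [← hδt]
      linarith
    have hr2 : r j ≤ dist p q / 4 := by nlinarith
    have hw' : w ≤ 2 * t * D j := by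
      have h1 := hact.2.1
      have h2 : t * dist ((c j).rep p) ((c j).rep q) ≤ t * (2 * D j) := by
        gcongr
        linarith
      linarith
    have hw'' : w ≤ t * (dist p q + 2 * r j) := hw.trans (by gcongr)
    refine ⟨k₁ + (k + k₂), ?_, ((hwalk₁.mono Finset.subset_union_left).trans
      (((hwalk.filter_edgeWeight hw').mono ?_).trans
        (hwalk₂.mono Finset.subset_union_left).symm)).isSpannerPath ?_⟩
    · have h1 : (k₁ : ℝ) ≤ ℓ := by exact_mod_cast hk₁.trans hj
      have h2 : (k₂ : ℝ) ≤ ℓ := by exact_mod_cast hk₂.trans hj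
      push_cast
      linarith
    · exact (Finset.subset_biUnion_of_mem H (Finset.mem_range.mpr (by omega))).trans
        Finset.subset_union_right
    · nlinarith [hr.nonneg j]
  · have h1 : totalWeight (treeEdges c ℓ) ≤ 40 * ρ * M * ℓ := by
      refine (totalWeight_treeEdges_le h0 hc hr hσ ℓ).trans ?_
      refine (Finset.sum_le_card_nsmul _ _ (40 * ρ * M) fun j hj => ?_).trans_eq ?_
      · have h2 := hcr (Finset.mem_range.mp hj).le
        have h3 : ((c j).reps.card : ℝ) * (4 * σ j + r j) ≤ (c j).reps.card * (5 * σ j) := by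
          gcongr
          linarith [hrle j, hσ j]
        linarith
      · rw [Finset.card_range, nsmul_eq_mul]; ring
    have h2 : totalWeight ((Finset.range (ℓ + 1)).biUnion H) ≤
        (ℓ + 1) * (512 * B * ρ * (t ^ 2 / ε) * M) := by
      refine (totalWeight_biUnion_le _ _).trans ?_
      refine (Finset.sum_le_card_nsmul _ _ (512 * B * ρ * (t ^ 2 / ε) * M)
        fun j hj => ?_).trans_eq ?_
      · have hj' : j ≤ ℓ := Nat.lt_succ_iff.mp (Finset.mem_range.mp hj)
        have h3 : totalWeight (H j) ≤ (H j).card * (2 * t * D j) :=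
          totalWeight_le_card_mul fun e he => (Finset.mem_filter.mp he).2
        have h4 : ((H j).card : ℝ) ≤ B * (c j).reps.card := by
          refine (hHcard j).trans ?_
          gcongr
          exact activeReps_subset j
        have h5 : t * D j = 32 * (t ^ 2 / ε) * σ j := by
          rw [hσD, ← hδt]
          field_simp
        calc totalWeight (H j) ≤ (H j).card * (2 * t * D j) := h3
          _ ≤ B * (c j).reps.card * (2 * t * D j) := by
            have := hD j
            gcongr
          _ = 64 * B * (t ^ 2 / ε) * ((c j).reps.card * σ j) := by
            rw [mul_assoc 2 t, h5]; ring
          _ ≤ 64 * B * (t ^ 2 / ε) * (8 * ρ * M) :=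
            mul_le_mul_of_nonneg_left (hcr hj') (by positivity)
          _ = 512 * B * ρ * (t ^ 2 / ε) * M := by ring
      · rw [Finset.card_range, nsmul_eq_mul]; push_cast; ring
    linarith [totalWeight_union_le (treeEdges c ℓ) ((Finset.range (ℓ + 1)).biUnion H)]

end Core

section Transfer

variable {V W : Type} [MetricSpace V] [MetricSpace W]

lemma isSpannerOn_map (f : W ↪ V) (hf : Isometry f) {R : Finset V}
    (hR : ∀ v, v ∈ R ↔ ∃ u, f u = v) {H : Finset (Sym2 W)} {t s Δ Λ : ℝ} (hH : IsGraphOn H)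
    (hs : (H.card : ℝ) ≤ s) (hΔ : 0 ≤ Δ) (hdeg : ∀ u, (degree H u : ℝ) ≤ Δ)
    (hhop : ∀ p q, ∃ k : ℕ, (k : ℝ) ≤ Λ ∧ IsSpannerPath H t p q k) :
    IsSpannerOn R (H.map f.sym2Map) t s Δ Λ where
  isGraphOn e he := by
    obtain ⟨e', he', rfl⟩ := Finset.mem_map.mp he
    rw [Function.Embedding.sym2Map_apply, Sym2.isDiag_map f.injective]
    exact hH e' he'
  mem_of_mem e he v hv := by
    obtain ⟨e, -, rfl⟩ := Finset.mem_map.mp he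
    obtain ⟨u, -, rfl⟩ := Sym2.mem_map.mp hv
    exact (hR _).mpr ⟨u, rfl⟩
  card_le := by rwa [Finset.card_map]
  degree_le v := by
    classical
    by_cases hv : ∃ u, f u = v
    · obtain ⟨u, rfl⟩ := hv
      refine le_trans ?_ (hdeg u)
      simp only [degree, Finset.filter_map, Finset.card_map]
      refine Nat.cast_le.mpr (Finset.card_le_card fun e he => ?_)
      rw [Finset.mem_filter] at he ⊢
      obtain ⟨u', hu', h⟩ := Sym2.mem_map.mp he.2
      exact ⟨he.1, f.injective h ▸ hu'⟩
    · have : degree (H.map f.sym2Map) v = 0 := by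
        rw [degree, Finset.card_eq_zero, Finset.filter_eq_empty_iff]
        intro e he hve
        obtain ⟨e, -, rfl⟩ := Finset.mem_map.mp he
        obtain ⟨u, -, h⟩ := Sym2.mem_map.mp hve
        exact hv ⟨u, h⟩
      rw [this]
      exact_mod_cast hΔ
  exists_walk p hp q hq := by
    obtain ⟨p, rfl⟩ := (hR p).mp hp
    obtain ⟨q, rfl⟩ := (hR q).mp hq
    obtain ⟨k, hk, x, rfl, rfl, hx, hsum⟩ := hhop p q
    refine ⟨k, hk, _, ?_, HasWalk.of_fun (fun i => f (x i)) fun i => ?_⟩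
    · simpa only [hf.dist_eq] using hsum
    · exact Finset.mem_map.mpr ⟨_, hx i, rfl⟩

end Transfer

section Estimates

lemma apply_le_div_mul_of_convexOn {f : ℝ → ℝ} (hf : ConvexOn ℝ (Set.Ici 0) f) (h0 : f 0 = 0)
    {m n : ℝ} (hm : 0 ≤ m) (hmn : m ≤ n) (hn : 0 < n) : f m ≤ f n / n * m := by
  have h1 : m / n ≤ 1 := (div_le_one hn).mpr hmn
  have := hf.2 (Set.mem_Ici.mpr hn.le) (Set.mem_Ici.mpr le_rfl) (div_nonneg hm hn.le)
    (sub_nonneg.mpr h1) (by ring)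
  simp only [smul_eq_mul, mul_zero, add_zero, h0, div_mul_cancel₀ m hn.ne'] at this
  rwa [div_mul_eq_mul_div, mul_comm, ← div_mul_eq_mul_div]

lemma le_mul_logb {n ρ : ℝ} (hρ : 2 ≤ ρ) (hn : 2 ≤ n) (hnρ : n < 64 * ρ) :
    n ≤ 64 * (ρ * Real.logb ρ n) := by
  have hlog2 := Real.log_two_gt_d9
  have hlogn : Real.log 2 ≤ Real.log n := Real.log_le_log (by norm_num) hn
  have hlogρ : 0 < Real.log ρ := Real.log_pos (by linarith)
  rcases le_total ρ n with h | h
  · have : 1 ≤ Real.logb ρ n := by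
      rw [Real.logb, le_div_iff₀ hlogρ, one_mul]
      exact Real.log_le_log (by linarith) h
    nlinarith
  · have h1 : Real.log ρ ≤ Real.log n + ρ / n - 1 := by
      have := Real.log_le_sub_one_of_pos (x := ρ / n) (by positivity)
      rw [Real.log_div (by positivity) (by positivity)] at this
      linarith
    have h2 : n * Real.log ρ ≤ n * Real.log n + ρ - n := by
      have := mul_le_mul_of_nonneg_left h1 (by linarith : 0 ≤ n)
      rwa [mul_sub, mul_add, mul_div_cancel₀ _ (by positivity), mul_one] at this
    rw [Real.logb, ← mul_div_assoc, ← mul_div_assoc, le_div_iff₀ hlogρ]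
    nlinarith

lemma logb_mul_le_logb {b ρ x : ℝ} (hb : 1 ≤ b) (hρ : 2 ≤ ρ) (hx : 1 ≤ x) :
    Real.logb (b * ρ) x ≤ Real.logb ρ x := by
  have hlogρ : 0 < Real.log ρ := Real.log_pos (by linarith)
  exact div_le_div_of_nonneg_left (Real.log_nonneg hx) hlogρ
    (Real.log_le_log (by linarith) (by nlinarith))

lemma exists_pow_levels {ρ n : ℝ} (hρ : 2 ≤ ρ) (hn : ρ ≤ n) :
    ∃ ℓ : ℕ, n ≤ ρ ^ ℓ ∧ (∀ j < ℓ, ρ ^ j ≤ n) ∧ (ℓ : ℝ) ≤ 2 * Real.logb ρ n ∧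
      1 ≤ Real.logb ρ n := by
  have h1 : 1 ≤ Real.logb ρ n := by
    rw [Real.le_logb_iff_rpow_le (by linarith) (by linarith), Real.rpow_one]
    exact hn
  refine ⟨⌈Real.logb ρ n⌉₊, ?_, fun j hj => ?_, ?_, h1⟩
  · rw [← Real.rpow_natCast, ← Real.logb_le_iff_le_rpow (by linarith) (by linarith)]
    exact Nat.le_ceil _
  · rw [← Real.rpow_natCast, ← Real.le_logb_iff_rpow_le (by linarith) (by linarith)]
    exact (Nat.lt_ceil.mp hj).le
  · linarith [Nat.ceil_lt_add_one (by linarith : 0 ≤ Real.logb ρ n)]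

lemma exists_pow_gt {ρ x : ℝ} (hρ : 128 ≤ ρ) (hx : 1 ≤ x) :
    ∃ K : ℕ, 128 * x < ρ ^ K ∧ (K : ℝ) ≤ Real.logb ρ x + 2 := by
  have h0 : 0 ≤ Real.logb ρ x := Real.logb_nonneg (by linarith) hx
  refine ⟨⌊Real.logb ρ x⌋₊ + 2, ?_, ?_⟩
  · have h1 : x < ρ ^ (⌊Real.logb ρ x⌋₊ + 1) := by
      rw [← Real.rpow_natCast, ← Real.logb_lt_iff_lt_rpow (by linarith) (by linarith)]
      exact_mod_cast Nat.lt_floor_add_one (Real.logb ρ x)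
    rw [pow_succ]
    nlinarith
  · push_cast
    linarith [Nat.floor_le h0]

end Estimates

section Assembly

variable {V : Type} [MetricSpace V]

lemma IsSpannerPath.mono {H : Finset (Sym2 V)} {t t' : ℝ} {p q : V} {k : ℕ}
    (h : IsSpannerPath H t p q k) (htt' : t ≤ t') : IsSpannerPath H t' p q k := by
  obtain ⟨x, h1, h2, h3, h4⟩ := h
  exact ⟨x, h1, h2, h3, h4.trans (by gcongr)⟩

variable [Fintype V]

/-- The spanners for the subsets of a finite metric space yield a light spanner for the space. -/
theorem exists_spanner_of_supply {t ε ρ B Δ Λ : ℝ} (ht : 1 ≤ t) (hε : 0 < ε) (hεt : ε ≤ t)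
    (hρ : 2 ≤ ρ) (hcard : 2 ≤ Fintype.card V) (hΔ : 0 ≤ Δ) (hΛ : 0 ≤ Λ) (hB : 1 ≤ 2 * B)
    (hsupply : ∀ R : Finset V, ∃ H, IsSpannerOn R H t (B * R.card) Δ Λ) :
    ∃ H' : Finset (Sym2 V), IsGraphOn H' ∧
      (H'.card : ℝ) ≤ 200000 * (B * Fintype.card V) * (1 + Real.logb ρ (t / ε)) ∧
      (∀ v, (degree H' v : ℝ) ≤ 200000 * (Δ * (1 + Real.logb ρ (t / ε)) + ρ)) ∧
      (∀ p q, ∃ k : ℕ, (k : ℝ) ≤ 200000 * (Λ + Real.logb ρ (Fintype.card V)) ∧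
        IsSpannerPath H' (t + ε) p q k) ∧
      totalWeight H' ≤ 200000 * B * ρ * Real.logb ρ (Fintype.card V) * (t ^ 3 / ε) *
        mstWeight V := by
  have hn : (2 : ℝ) ≤ Fintype.card V := by exact_mod_cast hcard
  have hne : Nonempty V := Fintype.card_pos_iff.mp (by omega)
  have hdiam : ∀ p q : V, dist p q ≤ mstWeight V := fun p q =>
    le_mstWeight fun T hT => hT.dist_le p q
  have hM : 0 < mstWeight V := by
    obtain ⟨p, q, hpq⟩ := Fintype.exists_pair_of_one_lt_card (by omega : 1 < Fintype.card V)
    exact (dist_pos.mpr hpq).trans_le (hdiam p q)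
  have hsep : ∀ s > 0, ∀ S : Finset V, IsSeparatedBy s S → 2 ≤ S.card →
      S.card * s ≤ 4 * mstWeight V := by
    intro s hs S hS h2
    have : S.card * s / 4 ≤ mstWeight V := le_mstWeight fun T hT => by
      linarith [hT.card_mul_le hs hS h2]
    linarith
  set n : ℝ := (Fintype.card V : ℝ) with hndef
  set M := mstWeight V
  have hx : 1 ≤ t / ε := (one_le_div hε).mpr hεt
  have hL : 0 ≤ Real.logb ρ (t / ε) := Real.logb_nonneg (by linarith) hx
  have hlogn : 0 ≤ Real.logb ρ n := Real.logb_nonneg (by linarith) (by linarith)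
  have ht3 : t ^ 2 / ε ≤ t ^ 3 / ε := by gcongr; norm_num
  have ht2 : 1 ≤ t ^ 2 / ε := by
    rw [one_le_div hε]
    nlinarith
  set T := t ^ 3 / ε
  set L := Real.logb ρ (t / ε)
  rcases lt_or_ge n (64 * ρ) with hnρ | hnρ
  · obtain ⟨H, hH⟩ := hsupply Finset.univ
    have hHcard := hH.card_le
    rw [Finset.card_univ, ← hndef] at hHcard
    have hBn : 0 ≤ B * n := by nlinarith
    refine ⟨H, hH.isGraphOn, ?_, fun v => ?_, fun p q => ?_, ?_⟩
    · nlinarith [mul_nonneg hBn hL]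
    · nlinarith [hH.degree_le v, mul_nonneg hΔ hL]
    · obtain ⟨k, hk, w, hw, hwalk⟩ := hH.exists_walk p (Finset.mem_univ _) q (Finset.mem_univ _)
      exact ⟨k, by linarith, (hwalk.isSpannerPath hw).mono (by linarith)⟩
    · have h1 : totalWeight H ≤ H.card * M := totalWeight_le_card_mul fun e _ => by
        induction e with
        | _ p q => exact hdiam p q
      have h2 := le_mul_logb hρ hn hnρ
      calc totalWeight H ≤ H.card * M := h1
        _ ≤ B * n * M := by gcongr
        _ ≤ B * (64 * (ρ * Real.logb ρ n)) * M := by gcongr; linarith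
        _ = 64 * (B * ρ * Real.logb ρ n) * 1 * M := by ring
        _ ≤ 200000 * (B * ρ * Real.logb ρ n) * T * M := by
          have : 0 ≤ B * ρ * Real.logb ρ n :=
            mul_nonneg (mul_nonneg (by linarith) (by linarith)) hlogn
          gcongr
          · norm_num
          · linarith
        _ = _ := by ring
  · obtain ⟨ℓ, hℓ, hℓ', hℓle, hlog1⟩ := exists_pow_levels (by linarith : 2 ≤ 64 * ρ) hnρ
    obtain ⟨K, hK, hKle⟩ := exists_pow_gt (by linarith : 128 ≤ 64 * ρ) hx
    have hlogle : Real.logb (64 * ρ) n ≤ Real.logb ρ n :=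
      logb_mul_le_logb (by norm_num) hρ (by linarith)
    have hLle : Real.logb (64 * ρ) (t / ε) ≤ L := logb_mul_le_logb (by norm_num) hρ hx
    have hK' : 128 * t < ε * (64 * ρ) ^ K := by
      rw [← mul_div_assoc, div_lt_iff₀ hε] at hK
      linarith
    obtain ⟨H, hH, hHcard, hHdeg, hHhop, hHw⟩ := exists_light_spanner ht hε hεt
      (by linarith : 128 ≤ 64 * ρ) hM (by omega) hdiam hsep hℓ hℓ' hK' (by linarith : 0 ≤ B)
      hΔ hΛ hsupply
    have hBn : 0 ≤ B * n := by nlinarith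
    refine ⟨H, hH, ?_, fun v => ?_, fun p q => ?_, ?_⟩
    · have h1 : 2 * ((K : ℝ) + 1) * B * n ≤ 2 * (L + 3) * (B * n) := by
        rw [mul_assoc _ B]
        exact mul_le_mul_of_nonneg_right (by linarith) hBn
      nlinarith [mul_nonneg hBn hL]
    · have h1 : 2 * ((K : ℝ) + 1) * Δ ≤ 2 * (L + 3) * Δ :=
        mul_le_mul_of_nonneg_right (by linarith) hΔ
      nlinarith [hHdeg v, mul_nonneg hΔ hL]
    · obtain ⟨k, hk, hpath⟩ := hHhop p q
      exact ⟨k, by linarith, hpath⟩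
    · set l := Real.logb ρ n
      have hB0 : 0 ≤ B := by linarith
      have hB2 : 1 ≤ 2 * B * T := by nlinarith
      calc totalWeight H
          ≤ 40 * (64 * ρ) * M * ℓ + (ℓ + 1) * (512 * B * (64 * ρ) * (t ^ 2 / ε) * M) := hHw
        _ ≤ 40 * (64 * ρ) * M * (2 * l) * (2 * B * T) +
            (3 * l) * (512 * B * (64 * ρ) * T * M) := by
          gcongr ?_ + ?_
          · have h1 : 40 * (64 * ρ) * M * (ℓ : ℝ) ≤ 40 * (64 * ρ) * M * (2 * l) := by
              gcongr
              linarith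
            exact h1.trans (le_mul_of_one_le_right (by positivity) hB2)
          · gcongr
            linarith
        _ = 108544 * (B * ρ * l * T * M) := by ring
        _ ≤ 200000 * (B * ρ * l * T * M) := by
          have : 0 ≤ B * ρ * l * T * M := by positivity
          linarith
        _ = _ := by ring

end Assembly

/-- **The transformation theorem.** There is an absolute constant `C > 0` with the
following property. Let `(X, dist)` be a metric space, `P ⊆ X`, `t ≥ 1`, `ρ ≥ 2`, and
let `SpSz, Δ, Λ : [0,∞) → [0,∞)` be monotone nondecreasing functions with `SpSz` convex
and `SpSz(0) = 0`. If every finite subset `Q ⊆ P` with `|Q| = m` admits a `t`-spanner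
with at most `SpSz(m)` edges, degree at most `Δ(m)`, and hop-diameter at most `Λ(m)`,
then every finite subset `Q ⊆ P` with `|Q| = n ≥ 2` admits, for every `0 < ε ≤ t`, a
`(t+ε)`-spanner with at most `C·SpSz(n)·(1 + log_ρ(t/ε))` edges, degree at most
`C·(Δ(n)·(1 + log_ρ(t/ε)) + ρ)`, hop-diameter at most `C·(Λ(n) + log_ρ n + α(ρ))`, and
lightness at most `C·(SpSz(n)/n)·ρ·(log_ρ n)·(t³/ε)`. -/
theorem light_spanner_transformation :
    ∃ C : ℝ, 0 < C ∧
      ∀ (X : Type) [MetricSpace X] (P : Set X) (t ρ : ℝ), 1 ≤ t → 2 ≤ ρ →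
      ∀ SpSz Δdeg Λdiam : ℝ → ℝ,
        MonotoneOn SpSz (Set.Ici 0) →
        MonotoneOn Δdeg (Set.Ici 0) →
        MonotoneOn Λdiam (Set.Ici 0) →
        (∀ x ∈ Set.Ici (0 : ℝ), 0 ≤ SpSz x) →
        (∀ x ∈ Set.Ici (0 : ℝ), 0 ≤ Δdeg x) →
        (∀ x ∈ Set.Ici (0 : ℝ), 0 ≤ Λdiam x) →
        ConvexOn ℝ (Set.Ici 0) SpSz →
        SpSz 0 = 0 →
        (∀ Q : Finset X, ↑Q ⊆ P →
          ∃ H : Finset (Sym2 {x : X // x ∈ Q}),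
            IsGraphOn H ∧ IsSpanner H t ∧
            (H.card : ℝ) ≤ SpSz Q.card ∧
            (∀ p, (degree H p : ℝ) ≤ Δdeg Q.card) ∧
            (∀ p q, ∃ k : ℕ, (k : ℝ) ≤ Λdiam Q.card ∧ IsSpannerPath H t p q k)) →
        ∀ Q : Finset X, ↑Q ⊆ P → 2 ≤ Q.card →
        ∀ ε : ℝ, 0 < ε → ε ≤ t →
        ∃ H' : Finset (Sym2 {x : X // x ∈ Q}),
          IsGraphOn H' ∧ IsSpanner H' (t + ε) ∧
          (H'.card : ℝ) ≤ C * SpSz Q.card * (1 + Real.logb ρ (t / ε)) ∧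
          (∀ p, (degree H' p : ℝ) ≤ C * (Δdeg Q.card * (1 + Real.logb ρ (t / ε)) + ρ)) ∧
          (∀ p q, ∃ k : ℕ,
            (k : ℝ) ≤ C * (Λdiam Q.card + Real.logb ρ Q.card + invAck ρ) ∧
            IsSpannerPath H' (t + ε) p q k) ∧
          totalWeight H' ≤ C * (SpSz Q.card / Q.card) * ρ * Real.logb ρ Q.card *
            (t ^ 3 / ε) * mstWeight {x : X // x ∈ Q} := by
  refine ⟨200000, by norm_num, ?_⟩
  intro X _ P t ρ ht hρ SpSz Δdeg Λdiam hSmono hΔmono hΛmono hS0 hΔ0 hΛ0 hconv hSpSz0 hspan Q hQP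
    hQ2 ε hε hεt
  have hcardV : Fintype.card {x : X // x ∈ Q} = Q.card := Fintype.card_coe Q
  have hn : (2 : ℝ) ≤ Q.card := by exact_mod_cast hQ2
  have hn0 : (Q.card : ℝ) ∈ Set.Ici (0 : ℝ) := Set.mem_Ici.mpr (by linarith)
  have hSB : SpSz Q.card = SpSz Q.card / Q.card * Q.card := by field_simp
  have hB : 1 ≤ 2 * (SpSz Q.card / Q.card) := by
    obtain ⟨H, -, hH, hcard, -⟩ := hspan Q hQP
    have hne : Nonempty {x : X // x ∈ Q} := Fintype.card_pos_iff.mp (by omega)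
    have h1 := hH.isConnectedOn.card_le
    rw [hcardV] at h1
    have h2 : (Q.card : ℝ) ≤ H.card + 1 := by exact_mod_cast h1
    rw [← mul_div_assoc, one_le_div (by linarith)]
    linarith
  have hsupply : ∀ R : Finset {x : X // x ∈ Q}, ∃ H, IsSpannerOn R H t
      (SpSz Q.card / Q.card * R.card) (Δdeg Q.card) (Λdiam Q.card) := by
    intro R
    let R' : Finset X := R.map (Function.Embedding.subtype _)
    have hR'Q : ∀ x ∈ R', x ∈ Q := by
      intro x hx
      obtain ⟨y, -, rfl⟩ := Finset.mem_map.mp hx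
      exact y.2
    have hR'card : R'.card = R.card := Finset.card_map _
    have hRQ : (R.card : ℝ) ≤ Q.card := by
      exact_mod_cast hR'card ▸ Finset.card_le_card hR'Q
    have hR0 : (R.card : ℝ) ∈ Set.Ici (0 : ℝ) := Set.mem_Ici.mpr (Nat.cast_nonneg _)
    obtain ⟨H, hH, -, hcard, hdeg, hhop⟩ := hspan R' fun x hx => hQP (hR'Q x hx)
    rw [hR'card] at hcard hdeg hhop
    refine ⟨_, isSpannerOn_map ⟨fun x => ⟨x.1, hR'Q x.1 x.2⟩, fun x y hxy => ?_⟩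
      (Isometry.of_dist_eq fun x y => rfl) (fun v => ?_) hH ?_ (hΔ0 _ hn0)
      (fun u => (hdeg u).trans (hΔmono hR0 hn0 hRQ)) fun p q => ?_⟩
    · exact Subtype.ext (Subtype.mk.inj hxy)
    · constructor
      · exact fun hv => ⟨⟨v.1, Finset.mem_map_of_mem _ hv⟩, rfl⟩
      · rintro ⟨u, rfl⟩
        obtain ⟨y, hy, hyu⟩ := Finset.mem_map.mp u.2
        have hy' : y = ⟨u.1, hR'Q u.1 u.2⟩ := Subtype.ext hyu
        rw [hy'] at hy
        exact hy
    · exact hcard.trans (apply_le_div_mul_of_convexOn hconv hSpSz0 hR0 hRQ (by linarith))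
    · obtain ⟨k, hk, hpath⟩ := hhop p q
      exact ⟨k, hk.trans (hΛmono hR0 hn0 hRQ), hpath⟩
  obtain ⟨H, h1, h2, h3, h4, h5⟩ := exists_spanner_of_supply ht hε hεt hρ (hcardV ▸ hQ2)
    (hΔ0 _ hn0) (hΛ0 _ hn0) hB hsupply
  rw [hcardV] at h2 h4 h5
  rw [← hSB] at h2
  refine ⟨H, h1, fun p q => ?_, h2, h3, fun p q => ?_, h5⟩
  · obtain ⟨k, -, hk⟩ := h4 p q
    exact ⟨k, hk⟩
  · obtain ⟨k, hk, hpath⟩ := h4 p q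
    exact ⟨k, hk.trans (by linarith [(Nat.cast_nonneg (invAck ρ) : (0 : ℝ) ≤ invAck ρ)]), hpath⟩

end Stmt3
end

section
/- There is an absolute constant C > 0 such that for every finite set P ⊆ ℝ of n ≥ 2 points (equipped with the metric dist(x,y) = |x − y|) and every real ρ ≥ 2, there exists a 1-spanner H for P with at most C·n edges, degree Δ(H) ≤ C·ρ, hop-diameter at most C·(log_ρ n + α(ρ)), and lightness Ψ(H) ≤ C·ρ·log_ρ n. -/
open scoped BigOperators

namespace Stmt4

variable {P : Type} [MetricSpace P]

/-- The weight of an edge (an unordered pair of points) is the distance between its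
endpoints. -/
noncomputable def edgeWeight (e : Sym2 P) : ℝ :=
  Sym2.lift ⟨fun p q => dist p q, fun p q => dist_comm p q⟩ e

/-- The total weight `ω(H)` of a graph, given as a finite set of edges. -/
noncomputable def totalWeight (H : Finset (Sym2 P)) : ℝ :=
  ∑ e ∈ H, edgeWeight e

/-- `H` is a graph on `P`: a finite set of unordered pairs of *distinct* points. -/
def IsGraphOn (H : Finset (Sym2 P)) : Prop :=
  ∀ e ∈ H, ¬ e.IsDiag

open Classical in
/-- The degree of the point `p` in the graph `H`: the number of edges incident on `p`. -/
noncomputable def degree (H : Finset (Sym2 P)) (p : P) : ℕ :=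
  (H.filter (fun e => p ∈ e)).card

/-- A `t`-spanner path with `k` edges between `p` and `q` in the graph `H`. -/
def IsSpannerPath (H : Finset (Sym2 P)) (t : ℝ) (p q : P) (k : ℕ) : Prop :=
  ∃ x : Fin (k + 1) → P, x 0 = p ∧ x (Fin.last k) = q ∧
    (∀ i : Fin k, s(x i.castSucc, x i.succ) ∈ H) ∧
    ∑ i : Fin k, dist (x i.castSucc) (x i.succ) ≤ t * dist p q

/-- `H` is a `t`-spanner: every pair of points admits a `t`-spanner path. -/
def IsSpanner (H : Finset (Sym2 P)) (t : ℝ) : Prop :=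
  ∀ p q : P, ∃ k : ℕ, IsSpannerPath H t p q k

/-- The graph `T` connects all the points of `P`. -/
def IsConnectedOn (T : Finset (Sym2 P)) : Prop :=
  ∀ p q : P, ∃ (k : ℕ) (x : Fin (k + 1) → P), x 0 = p ∧ x (Fin.last k) = q ∧
    ∀ i : Fin k, s(x i.castSucc, x i.succ) ∈ T

/-- `ω(MST(P))`: the minimum weight of a connected graph on `P` with `|P| - 1` edges. -/
noncomputable def mstWeight (P : Type) [MetricSpace P] [Fintype P] : ℝ :=
  sInf {w : ℝ | ∃ T : Finset (Sym2 P), IsGraphOn T ∧ IsConnectedOn T ∧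
    T.card = Fintype.card P - 1 ∧ totalWeight T = w}

/-- The inverse Ackermann function: the least `k ≥ 1` with `A(k,k) ≥ x`. -/
noncomputable def invAck (x : ℝ) : ℕ :=
  sInf {k : ℕ | 1 ≤ k ∧ x ≤ ack k k}

/-- A metric space has doubling dimension at most `d` if every ball can be covered
by at most `2^d` balls of half its radius. -/
def DoublingDimLE (P : Type) [MetricSpace P] (d : ℕ) : Prop :=
  ∀ (x : P) (r : ℝ), ∃ S : Finset P, S.card ≤ 2 ^ d ∧
    Metric.ball x r ⊆ ⋃ y ∈ S, Metric.ball y (r / 2)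

/-- `Reach E h i j`: the directed edges `E` contain a path from `i` to `j` with at most `h`
edges. -/
inductive Reach {V : Type*} (E : Finset (V × V)) : ℕ → V → V → Prop
  | refl (h : ℕ) (i : V) : Reach E h i i
  | step {h : ℕ} {i j k : V} : (i, j) ∈ E → Reach E h j k → Reach E (h + 1) i k

namespace Reach

variable {V W : Type*} {E E' : Finset (V × V)} {h h' : ℕ} {i j k : V}

theorem mono (hE : E ⊆ E') (r : Reach E h i j) : ∀ {h'}, h ≤ h' → Reach E' h' i j := by
  induction r with
  | refl h i => intro h' _; exact refl h' i
  | step he _ ih =>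
    intro h' hh
    obtain ⟨h', rfl⟩ := Nat.exists_eq_add_of_le' hh
    exact step (hE he) (ih (Nat.le_add_left _ _))

theorem single (he : (i, j) ∈ E) : Reach E 1 i j := step he (refl 0 j)

theorem trans (r : Reach E h i j) (s : Reach E h' j k) : Reach E (h + h') i k := by
  induction r with
  | refl h i => exact s.mono subset_rfl (Nat.le_add_left _ _)
  | step he _ ih => exact (step he (ih s)).mono subset_rfl (by omega)

theorem image [DecidableEq W] (f : V → W) (r : Reach E h i j) :
    Reach (E.image (Prod.map f f)) h (f i) (f j) := by
  induction r with
  | refl h i => exact refl h _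
  | step he _ ih => exact step (Finset.mem_image_of_mem (Prod.map f f) he) ih

end Reach

/-- Every interval of naturals splits into consecutive nonempty blocks of size at most `b`. -/
theorem exists_blocks {l r b : ℕ} (hlr : l ≤ r) (hb : 0 < b) :
    ∃ (q : ℕ) (c : ℕ → ℕ), Monotone c ∧ c 0 = l ∧ c q = r ∧ (∀ a < q, c a < c (a + 1)) ∧
      (∀ a, c (a + 1) ≤ c a + b) ∧ q * b < r - l + b := by
  refine ⟨(r - l + b - 1) / b, fun a => min (l + a * b) r, ?_, ?_, ?_, ?_, ?_, ?_⟩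
  · intro a a' haa
    have := Nat.mul_le_mul_right b haa
    simp only
    omega
  · simp [hlr]
  · have h1 := Nat.lt_div_mul_add (a := r - l + b - 1) hb
    simp only
    omega
  · intro a ha
    have h1 := Nat.div_mul_le_self (r - l + b - 1) b
    have h2 := Nat.mul_le_mul_right b (Nat.succ_le_of_lt ha)
    simp only [Nat.succ_mul] at h2
    simp only [Nat.succ_mul]
    omega
  · intro a
    simp only [Nat.succ_mul]
    omega
  · have h1 := Nat.div_mul_le_self (r - l + b - 1) b
    omega

theorem exists_mem_block {c : ℕ → ℕ} {i : ℕ} (h0 : c 0 ≤ i) :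
    ∀ {q : ℕ}, i < c q → ∃ a < q, c a ≤ i ∧ i < c (a + 1) := by
  intro q
  induction q with
  | zero => intro h; omega
  | succ q ih =>
    intro h
    rcases lt_or_ge i (c q) with h1 | h1
    · obtain ⟨a, ha, hh⟩ := ih h1
      exact ⟨a, by omega, hh⟩
    · exact ⟨q, by omega, h1, h⟩

theorem block_le_of_le {c : ℕ → ℕ} (hc : Monotone c) {a a' i i' : ℕ} (h1 : c a ≤ i)
    (h4 : i' < c (a' + 1)) (hi : i ≤ i') : a ≤ a' := by
  by_contra hlt
  have := hc (show a' + 1 ≤ a by omega)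
  omega

theorem block_unique {c : ℕ → ℕ} (hc : Monotone c) {a a' i : ℕ} (h1 : c a ≤ i)
    (h2 : i < c (a + 1)) (h3 : c a' ≤ i) (h4 : i < c (a' + 1)) : a = a' :=
  le_antisymm (block_le_of_le hc h1 h4 le_rfl) (block_le_of_le hc h3 h2 le_rfl)

theorem strict_of_blocks {c : ℕ → ℕ} (hc : Monotone c) {q : ℕ} (hs : ∀ a < q, c a < c (a + 1))
    {a a' : ℕ} (haa : a < a') (hq : a < q) : c a < c a' :=
  (hs a hq).trans_le (hc haa)

/-- The set of directed edges `E` on the interval `[l, r)` has increasing edges only. -/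
def IsIncreasingOn (E : Finset (ℕ × ℕ)) (l r : ℕ) : Prop :=
  ∀ e ∈ E, l ≤ e.1 ∧ e.1 < e.2 ∧ e.2 < r

/-- The interval `[l, r)` carries at most `f * (r - l)` increasing edges such that any two of
its points are joined by an increasing path with at most `h` edges. -/
def HasShortcuts (h f l r : ℕ) : Prop :=
  ∃ E : Finset (ℕ × ℕ), IsIncreasingOn E l r ∧ E.card ≤ f * (r - l) ∧
    ∀ i j, l ≤ i → i < j → j < r → Reach E h i j

theorem HasShortcuts.mono {h h' f f' l r : ℕ} (H : HasShortcuts h f l r) (hh : h ≤ h')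
    (hf : f ≤ f') : HasShortcuts h' f' l r := by
  obtain ⟨E, h1, h2, h3⟩ := H
  exact ⟨E, h1, h2.trans (Nat.mul_le_mul_right _ hf),
    fun i j hi hij hj => (h3 i j hi hij hj).mono subset_rfl hh⟩

theorem sum_block_sizes {c : ℕ → ℕ} (hc : Monotone c) (q : ℕ) :
    ∑ a ∈ Finset.range q, (c (a + 1) - c a) = c q - c 0 :=
  Finset.sum_range_tsub hc q

theorem hasShortcuts_complete (l r : ℕ) : HasShortcuts 1 (r - l) l r := by
  refine ⟨(Finset.Ico l r ×ˢ Finset.Ico l r).filter (fun e => e.1 < e.2), ?_, ?_, ?_⟩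
  · intro e he
    simp only [Finset.mem_filter, Finset.mem_product, Finset.mem_Ico] at he
    omega
  · refine (Finset.card_filter_le _ _).trans ?_
    simp
  · intro i j hi hij hj
    apply Reach.single
    simp only [Finset.mem_filter, Finset.mem_product, Finset.mem_Ico]
    omega

/-- One level of the recursion: shortcuts inside blocks and shortcuts between the first points
of the blocks combine, at the price of two extra edges per point. -/
theorem HasShortcuts.combine {h h' f f' l r q : ℕ} {c : ℕ → ℕ} (hc : Monotone c) (h0 : c 0 = l)
    (hq : c q = r) (hs : ∀ a < q, c a < c (a + 1)) {g : ℕ}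
    (hin : ∀ a < q, HasShortcuts h f (c a) (c (a + 1))) (hout : HasShortcuts h' f' 0 q)
    (hh : h ≤ h' + 2) (hg : f * (r - l) + 2 * (r - l) + f' * q ≤ g * (r - l)) :
    HasShortcuts (h' + 2) g l r := by
  classical
  choose! E hE using hin
  obtain ⟨F, hF1, hF2, hF3⟩ := hout
  have hcq : ∀ a ≤ q, c a ≤ r := fun a ha => hq ▸ hc ha
  have hc0 : ∀ a, l ≤ c a := fun a => h0 ▸ hc (Nat.zero_le a)
  have hblk : ∀ i, l ≤ i → i < r → ∃ a < q, c a ≤ i ∧ i < c (a + 1) := fun i hi hir =>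
    exists_mem_block (h0 ▸ hi) (hq ▸ hir)
  choose! β hβ using hblk
  let B := (Finset.range q).biUnion E
  let U := ((Finset.Ico l r).filter fun i => c (β i + 1) < r).image fun i => (i, c (β i + 1))
  let D := ((Finset.Ico l r).filter fun i => c (β i) < i).image fun i => (c (β i), i)
  let G := F.image (Prod.map c c)
  refine ⟨B ∪ U ∪ D ∪ G, ?_, ?_, ?_⟩
  · intro e he
    simp only [Finset.mem_union, or_assoc] at he
    rcases he with he | he | he | he
    · obtain ⟨a, ha, hea⟩ := Finset.mem_biUnion.1 he
      have haq := Finset.mem_range.1 ha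
      have := (hE a haq).1 e hea
      have := hcq (a + 1) haq
      have := hc0 a
      omega
    · obtain ⟨i, hi, rfl⟩ := Finset.mem_image.1 he
      simp only [Finset.mem_filter, Finset.mem_Ico] at hi
      have := hβ i hi.1.1 hi.1.2
      exact ⟨hi.1.1, this.2.2, hi.2⟩
    · obtain ⟨i, hi, rfl⟩ := Finset.mem_image.1 he
      simp only [Finset.mem_filter, Finset.mem_Ico] at hi
      exact ⟨hc0 _, hi.2, hi.1.2⟩
    · obtain ⟨e, hi, rfl⟩ := Finset.mem_image.1 he
      obtain ⟨-, h1, h2⟩ := hF1 e hi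
      exact ⟨hc0 _, strict_of_blocks hc hs h1 (h1.trans h2),
        (strict_of_blocks hc hs h2 h2).trans_eq hq⟩
  · have hB : B.card ≤ f * (r - l) := by
      refine Finset.card_biUnion_le.trans ?_
      calc ∑ a ∈ Finset.range q, (E a).card
          ≤ ∑ a ∈ Finset.range q, f * (c (a + 1) - c a) :=
            Finset.sum_le_sum fun a ha => (hE a (Finset.mem_range.1 ha)).2.1
        _ = f * (r - l) := by rw [← Finset.mul_sum, sum_block_sizes hc, hq, h0]
    have hU : U.card ≤ r - l :=
      Finset.card_image_le.trans ((Finset.card_filter_le _ _).trans (Nat.card_Ico l r).le)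
    have hD : D.card ≤ r - l :=
      Finset.card_image_le.trans ((Finset.card_filter_le _ _).trans (Nat.card_Ico l r).le)
    have hG : G.card ≤ f' * q := Finset.card_image_le.trans hF2
    have h1 := Finset.card_union_le (B ∪ U ∪ D) G
    have h2 := Finset.card_union_le (B ∪ U) D
    have h3 := Finset.card_union_le B U
    omega
  · intro i j hi hij hj
    obtain ⟨ha, ha1, ha2⟩ := hβ i hi (hij.trans hj)
    obtain ⟨hb, hb1, hb2⟩ := hβ j (hi.trans hij.le) hj
    have hab := block_le_of_le hc ha1 hb2 hij.le
    have hBs : B ⊆ B ∪ U ∪ D ∪ G := fun e he => by simp [he]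
    have hUs : U ⊆ B ∪ U ∪ D ∪ G := fun e he => by simp [he]
    have hDs : D ⊆ B ∪ U ∪ D ∪ G := fun e he => by simp [he]
    have hGs : G ⊆ B ∪ U ∪ D ∪ G := fun e he => by simp [he]
    rcases hab.eq_or_lt with heq | hlt
    · refine ((hE _ ha).2.2 i j ha1 hij (heq ▸ hb2)).mono (fun e he => hBs ?_) hh
      exact Finset.mem_biUnion.2 ⟨β i, Finset.mem_range.2 ha, he⟩
    · have hle : c (β i + 1) ≤ c (β j) := hc hlt
      have r1 : Reach (B ∪ U ∪ D ∪ G) 1 i (c (β i + 1)) := by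
        refine Reach.single (hUs (Finset.mem_image.2 ⟨i, ?_, rfl⟩))
        simp only [Finset.mem_filter, Finset.mem_Ico]
        omega
      have r2 : Reach (B ∪ U ∪ D ∪ G) h' (c (β i + 1)) (c (β j)) := by
        rcases (Nat.succ_le_of_lt hlt).eq_or_lt with heq | hlt'
        · rw [← heq]; exact Reach.refl _ _
        · exact ((hF3 _ _ (Nat.zero_le _) hlt' hb).image c).mono hGs le_rfl
      have r3 : Reach (B ∪ U ∪ D ∪ G) 1 (c (β j)) j := by
        rcases hb1.eq_or_lt with heq | hlt'
        · rw [heq]; exact Reach.refl _ _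
        · refine Reach.single (hDs (Finset.mem_image.2 ⟨j, ?_, rfl⟩))
          simp only [Finset.mem_filter, Finset.mem_Ico]
          omega
      exact ((r1.trans r2).trans r3).mono subset_rfl (by omega)

/-- With `2 * k + 1` hops, `16 * (s + k + 1)` edges per point suffice for `16 * ack k s` points. -/
theorem hasShortcuts_ack : ∀ k s l r : ℕ, r - l ≤ 16 * ack k s →
    HasShortcuts (2 * k + 1) (16 * (s + k + 1)) l r := by
  intro k
  induction k with
  | zero =>
    intro s l r hn
    rw [ack_zero] at hn
    exact (hasShortcuts_complete l r).mono (by omega) (by omega)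
  | succ k ihk =>
    intro s
    induction s with
    | zero =>
      intro l r hn
      rw [ack_succ_zero] at hn
      exact (ihk 1 l r hn).mono (by omega) (by omega)
    | succ s ihs =>
      intro l r hn
      rw [ack_succ_succ] at hn
      set a := ack (k + 1) s with ha
      have hka : k + 1 < a := lt_ack_left (k + 1) s
      rcases le_or_gt (r - l) (16 * a) with hsmall | hbig
      · exact (ihs l r hsmall).mono le_rfl (by omega)
      · obtain ⟨q, c, hc, h0, hq, hs, hgap, hqb⟩ :=
          exists_blocks (l := l) (r := r) (b := 16 * a) (by omega) (by omega)
        have hqn : q ≤ r - l := by nlinarith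
        refine HasShortcuts.combine hc h0 hq hs (h' := 2 * k + 1)
          (fun b _ => ihs (c b) (c (b + 1)) (by have := hgap b; omega))
          (ihk a 0 q (by omega)) (by omega) ?_
        have hout : 16 * (a + k + 1) * q ≤ 4 * (r - l) := by nlinarith
        nlinarith

theorem hasShortcuts_path (l r : ℕ) : HasShortcuts (r - l) 1 l r := by
  have key : ∀ (t i : ℕ), l ≤ i → i + t < r →
      Reach ((Finset.Ico l (r - 1)).image fun i => (i, i + 1)) t i (i + t) := by
    intro t
    induction t with
    | zero => intro i _ _; exact Reach.refl _ _
    | succ t ih =>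
      intro i hi hr
      refine Reach.step (j := i + 1) ?_ ?_
      · exact Finset.mem_image.2 ⟨i, Finset.mem_Ico.2 (by omega), rfl⟩
      · have := ih (i + 1) (by omega) (by omega)
        rwa [add_right_comm] at this
  refine ⟨(Finset.Ico l (r - 1)).image fun i => (i, i + 1), ?_, ?_, ?_⟩
  · intro e he
    obtain ⟨i, hi, rfl⟩ := Finset.mem_image.1 he
    rw [Finset.mem_Ico] at hi
    simp only
    omega
  · refine Finset.card_image_le.trans ?_
    rw [Nat.card_Ico]
    omega
  · intro i j hi hij hj
    have := key (j - i) i hi (by omega)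
    rw [Nat.add_sub_cancel' hij.le] at this
    exact this.mono subset_rfl (by omega)

/-- At most `ack k k` points carry linearly many shortcuts with `O(k)` hops. -/
theorem hasShortcuts_linear {k l r : ℕ} (hk : 1 ≤ k) (hn : r - l ≤ ack k k) :
    HasShortcuts (2 * k + 3) 99 l r := by
  rcases le_or_gt (r - l) k with hsmall | hbig
  · exact (hasShortcuts_path l r).mono (by omega) (by omega)
  · obtain ⟨q, c, hc, h0, hq, hs, hgap, hqb⟩ :=
      exists_blocks (l := l) (r := r) (b := k) (by omega) (by omega)
    have hqn : q ≤ r - l := by nlinarith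
    refine HasShortcuts.combine hc h0 hq hs (h := k) (h' := 2 * k + 1) (f := 1) (g := 99)
      (fun b _ => (hasShortcuts_path (c b) (c (b + 1))).mono (by have := hgap b; omega) le_rfl)
      (hasShortcuts_ack k k 0 q (by omega)) (by omega) ?_
    nlinarith

/-- The number of edges of `E` incident on `i`. -/
def incidence (E : Finset (ℕ × ℕ)) (i : ℕ) : ℕ :=
  (E.filter fun e => e.1 = i ∨ e.2 = i).card

theorem incidence_union_le (E F : Finset (ℕ × ℕ)) (i : ℕ) :
    incidence (E ∪ F) i ≤ incidence E i + incidence F i := by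
  unfold incidence
  rw [Finset.filter_union]
  exact Finset.card_union_le _ _

theorem incidence_eq_zero {E : Finset (ℕ × ℕ)} {i : ℕ} (h : ∀ e ∈ E, e.1 ≠ i ∧ e.2 ≠ i) :
    incidence E i = 0 := by
  unfold incidence
  rw [Finset.card_eq_zero, Finset.filter_eq_empty_iff]
  intro e he
  simpa using h e he

theorem incidence_le_of_subset_product {E : Finset (ℕ × ℕ)} {S : Finset ℕ}
    (h : ∀ e ∈ E, e.1 ∈ S ∧ e.2 ∈ S) (i : ℕ) : incidence E i ≤ 2 * S.card := by
  have hsub : (E.filter fun e => e.1 = i ∨ e.2 = i) ⊆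
      S.image (fun j => (i, j)) ∪ S.image (fun j => (j, i)) := by
    intro e he
    obtain ⟨he, hi⟩ := Finset.mem_filter.1 he
    obtain ⟨h1, h2⟩ := h e he
    rw [Finset.mem_union, Finset.mem_image, Finset.mem_image]
    rcases hi with rfl | rfl
    · exact Or.inl ⟨e.2, h2, rfl⟩
    · exact Or.inr ⟨e.1, h1, rfl⟩
  have h1 := Finset.card_le_card hsub
  have h2 := Finset.card_union_le (S.image fun j => (i, j)) (S.image fun j => (j, i))
  have h3 := Finset.card_image_le (s := S) (f := fun j => (i, j))
  have h4 := Finset.card_image_le (s := S) (f := fun j => (j, i))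
  unfold incidence
  omega

/-- The total length of the edges of `E` under the embedding `x` of the indices in the line. -/
noncomputable def length (x : ℕ → ℝ) (E : Finset (ℕ × ℕ)) : ℝ :=
  ∑ e ∈ E, (x e.2 - x e.1)

theorem length_le_card_mul {x : ℕ → ℝ} (hx : Monotone x) {E : Finset (ℕ × ℕ)} {l r : ℕ}
    (hE : IsIncreasingOn E l r) : length x E ≤ E.card * (x (r - 1) - x l) := by
  rw [← nsmul_eq_mul]
  refine Finset.sum_le_card_nsmul _ _ _ fun e he => ?_
  obtain ⟨h1, h2, h3⟩ := hE e he
  exact sub_le_sub (hx (by omega)) (hx h1)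

theorem length_union_le {x : ℕ → ℝ} (hx : Monotone x) {E F : Finset (ℕ × ℕ)} {l r : ℕ}
    (hE : IsIncreasingOn E l r) :
    length x (E ∪ F) ≤ length x E + length x F := by
  unfold length
  rw [← Finset.sum_union_inter]
  refine le_add_of_nonneg_right (Finset.sum_nonneg fun e he => ?_)
  exact sub_nonneg.2 (hx (hE e (Finset.mem_inter.1 he).1).2.1.le)

/-- The properties of a hierarchical spanner of depth `d` and branching `m` on the interval
`[l, r)`, whose points are embedded in the line by `x`, where `h` and `f` are the hop bound and
the number of edges per point of the shortcuts used between siblings. -/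
structure IsHierarchy (x : ℕ → ℝ) (m h f d l r : ℕ) (E : Finset (ℕ × ℕ)) : Prop where
  increasing : IsIncreasingOn E l r
  card_add_le : E.card + (f + 3) ≤ (f + 4) * (r - l)
  incidence_le : ∀ i, incidence E i ≤ 8 * m + 8
  incidence_left_le : incidence E l ≤ 4 * m + 4
  incidence_right_le : incidence E (r - 1) ≤ 4 * m + 4
  reach_from_left : ∀ i, l ≤ i → i < r → Reach E d l i
  reach_to_right : ∀ i, l ≤ i → i < r → Reach E d i (r - 1)
  reach : ∀ i j, l ≤ i → i < j → j < r → Reach E (2 * d + h) i j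
  length_le : length x E ≤ d * ((f + 3) * m + 1) * (x (r - 1) - x l)

theorem isHierarchy_singleton (x : ℕ → ℝ) (m h f d l : ℕ) :
    IsHierarchy x m h f d l (l + 1) ∅ where
  increasing := by simp [IsIncreasingOn]
  card_add_le := by simp
  incidence_le := by simp [incidence]
  incidence_left_le := by simp [incidence]
  incidence_right_le := by simp [incidence]
  reach_from_left := by
    intro i h1 h2
    obtain rfl : i = l := by omega
    exact Reach.refl _ _
  reach_to_right := by
    intro i h1 h2
    obtain rfl : i = l := by omega
    exact Reach.refl _ _
  reach := by intro i j; omega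
  length_le := by simp [length]

theorem IsHierarchy.step {x : ℕ → ℝ} (hx : Monotone x) {m h f d l r q : ℕ} {c : ℕ → ℕ}
    (hlr : l + 2 ≤ r) (hqm : q ≤ m) (hc : Monotone c) (h0 : c 0 = l + 1) (hq : c q = r - 1)
    (hs : ∀ a < q, c a < c (a + 1)) (hout : HasShortcuts h f 0 q) {E : ℕ → Finset (ℕ × ℕ)}
    (hE : ∀ a < q, IsHierarchy x m h f d (c a) (c (a + 1)) (E a)) :
    ∃ E', IsHierarchy x m h f (d + 1) l r E' := by
  obtain ⟨F, hF1, hF2, hF3⟩ := hout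
  have hcq : ∀ a ≤ q, c a ≤ r - 1 := fun a ha => hq ▸ hc ha
  have hc0 : ∀ a, l + 1 ≤ c a := fun a => h0 ▸ hc (Nat.zero_le a)
  have hblk : ∀ i, l < i → i < r - 1 → ∃ a < q, c a ≤ i ∧ i < c (a + 1) := fun i hi hir =>
    exists_mem_block (h0 ▸ hi) (hq ▸ hir)
  let B := (Finset.range q).biUnion E
  let L := (Finset.range q).image fun a => (l, c a)
  let R := (Finset.range q).image fun a => (c (a + 1) - 1, r - 1)
  let N := (Finset.range (q - 1)).image fun a => (c (a + 1) - 1, c (a + 1))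
  let G := F.image (Prod.map c c)
  let O := {(l, r - 1)} ∪ L ∪ R ∪ N ∪ G
  let S := {l, r - 1} ∪ (Finset.range q).image c ∪
    (Finset.range q).image fun a => c (a + 1) - 1
  have hL : L ⊆ O := fun e he => by simp [O, he]
  have hR : R ⊆ O := fun e he => by simp [O, he]
  have hN : N ⊆ O := fun e he => by simp [O, he]
  have hG : G ⊆ O := fun e he => by simp [O, he]
  have hfirst : ∀ a < q, c a ∈ S := fun a ha => by
    simp only [S, Finset.mem_union, Finset.mem_image, Finset.mem_range]
    exact Or.inl (Or.inr ⟨a, ha, rfl⟩)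
  have hlast : ∀ a < q, c (a + 1) - 1 ∈ S := fun a ha => by
    simp only [S, Finset.mem_union, Finset.mem_image, Finset.mem_range]
    exact Or.inr ⟨a, ha, rfl⟩
  have hlS : l ∈ S := by simp [S]
  have hrS : r - 1 ∈ S := by simp [S]
  have hOS : ∀ e ∈ O, (e.1 ∈ S ∧ e.2 ∈ S) ∧ l ≤ e.1 ∧ e.1 < e.2 ∧ e.2 < r := by
    intro e he
    simp only [O, Finset.mem_union, or_assoc] at he
    rcases he with he | he | he | he | he
    · rw [Finset.mem_singleton] at he
      subst he
      exact ⟨⟨hlS, hrS⟩, le_rfl, by simp only; omega, by simp only; omega⟩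
    · obtain ⟨a, ha, rfl⟩ := Finset.mem_image.1 he
      have ha := Finset.mem_range.1 ha
      have := hcq a ha.le
      have := hc0 a
      exact ⟨⟨hlS, hfirst a ha⟩, le_rfl, by simp only; omega, by simp only; omega⟩
    · obtain ⟨a, ha, rfl⟩ := Finset.mem_image.1 he
      have ha := Finset.mem_range.1 ha
      have := hcq (a + 1) ha
      have := hc0 (a + 1)
      exact ⟨⟨hlast a ha, hrS⟩, by simp only; omega, by simp only; omega, by simp only; omega⟩
    · obtain ⟨a, ha, rfl⟩ := Finset.mem_image.1 he
      have ha := Finset.mem_range.1 ha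
      have := hcq (a + 1) (by omega)
      have := hc0 (a + 1)
      exact ⟨⟨hlast a (by omega), hfirst (a + 1) (by omega)⟩, by simp only; omega,
        by simp only; omega, by simp only; omega⟩
    · obtain ⟨e, heF, rfl⟩ := Finset.mem_image.1 he
      obtain ⟨-, h1, h2⟩ := hF1 e heF
      have := hcq e.2 h2.le
      have := hc0 e.1
      exact ⟨⟨hfirst _ (h1.trans h2), hfirst _ h2⟩, by simp only [Prod.map_fst]; omega,
        strict_of_blocks hc hs h1 (h1.trans h2), by simp only [Prod.map_snd]; omega⟩
  have hOinc : IsIncreasingOn O l r := fun e he => (hOS e he).2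
  have hBmem : ∀ e ∈ B, ∃ a < q, e ∈ E a ∧ c a ≤ e.1 ∧ e.1 < e.2 ∧ e.2 < c (a + 1) := by
    intro e he
    obtain ⟨a, ha, hea⟩ := Finset.mem_biUnion.1 he
    have ha := Finset.mem_range.1 ha
    exact ⟨a, ha, hea, (hE a ha).increasing e hea⟩
  have hBinc : IsIncreasingOn B l r := by
    intro e he
    obtain ⟨a, ha, -, h1, h2, h3⟩ := hBmem e he
    have := hcq (a + 1) ha
    have := hc0 a
    omega
  have hEB : ∀ a < q, E a ⊆ B := fun a ha =>
    Finset.subset_biUnion_of_mem E (Finset.mem_range.2 ha)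
  have hOcard : O.card ≤ (f + 3) * q + 1 := by
    have h1 : L.card ≤ q := Finset.card_image_le.trans (Finset.card_range q).le
    have h2 : R.card ≤ q := Finset.card_image_le.trans (Finset.card_range q).le
    have h3 : N.card ≤ q - 1 := Finset.card_image_le.trans (Finset.card_range (q - 1)).le
    have h4 : G.card ≤ f * q := Finset.card_image_le.trans hF2
    have k1 : O.card ≤ _ := Finset.card_union_le ({(l, r - 1)} ∪ L ∪ R ∪ N) G
    have k2 := Finset.card_union_le ({(l, r - 1)} ∪ L ∪ R) N
    have k3 := Finset.card_union_le ({(l, r - 1)} ∪ L) R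
    have k4 := Finset.card_union_le {(l, r - 1)} L
    rw [Finset.card_singleton] at k4
    rw [add_mul]
    omega
  have hScard : S.card ≤ 2 * m + 2 := by
    have h1 : ((Finset.range q).image c).card ≤ q :=
      Finset.card_image_le.trans (Finset.card_range q).le
    have h2 : ((Finset.range q).image fun a => c (a + 1) - 1).card ≤ q :=
      Finset.card_image_le.trans (Finset.card_range q).le
    have k1 : S.card ≤ _ := Finset.card_union_le ({l, r - 1} ∪ (Finset.range q).image c)
      ((Finset.range q).image fun a => c (a + 1) - 1)
    have k2 := Finset.card_union_le {l, r - 1} ((Finset.range q).image c)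
    have k3 := Finset.card_le_two (a := l) (b := r - 1)
    omega
  have hOdeg : ∀ i, incidence O i ≤ 4 * m + 4 := fun i =>
    (incidence_le_of_subset_product (fun e he => (hOS e he).1) i).trans (by omega)
  have hBout : ∀ i, (i ≤ l ∨ r - 1 ≤ i) → incidence B i = 0 := by
    intro i hi
    refine incidence_eq_zero fun e he => ?_
    obtain ⟨a, ha, -, h1, h2, h3⟩ := hBmem e he
    have := hcq (a + 1) ha
    have := hc0 a
    omega
  have hBin : ∀ i a, c a ≤ i → i < c (a + 1) → incidence B i ≤ incidence (E a) i := by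
    intro i a h1 h2
    refine Finset.card_le_card fun e he => ?_
    obtain ⟨he, hi⟩ := Finset.mem_filter.1 he
    obtain ⟨a', ha', hea, k1, k2, k3⟩ := hBmem e he
    obtain rfl : a = a' := block_unique hc h1 h2 (by omega) (by omega)
    exact Finset.mem_filter.2 ⟨hea, hi⟩
  have hOBO : O ⊆ B ∪ O := Finset.subset_union_right
  have hBBO : B ⊆ B ∪ O := Finset.subset_union_left
  have rlr : Reach (B ∪ O) 1 l (r - 1) := Reach.single (hOBO (by simp [O]))
  have rfirst : ∀ a < q, Reach (B ∪ O) 1 l (c a) := fun a ha =>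
    Reach.single (hOBO (hL (Finset.mem_image.2 ⟨a, Finset.mem_range.2 ha, rfl⟩)))
  have rlast : ∀ a < q, Reach (B ∪ O) 1 (c (a + 1) - 1) (r - 1) := fun a ha =>
    Reach.single (hOBO (hR (Finset.mem_image.2 ⟨a, Finset.mem_range.2 ha, rfl⟩)))
  have rleft : ∀ i, l ≤ i → i < r → Reach (B ∪ O) (d + 1) l i := by
    intro i h1 h2
    rcases h1.eq_or_lt with rfl | h1
    · exact Reach.refl _ _
    rcases (Nat.le_sub_one_of_lt h2).eq_or_lt with rfl | h2
    · exact rlr.mono subset_rfl (by omega)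
    obtain ⟨a, ha, h3, h4⟩ := hblk i h1 h2
    refine ((rfirst a ha).trans (((hE a ha).reach_from_left i h3 h4).mono
      ((hEB a ha).trans hBBO) le_rfl)).mono subset_rfl (by omega)
  have rright : ∀ i, l ≤ i → i < r → Reach (B ∪ O) (d + 1) i (r - 1) := by
    intro i h1 h2
    rcases h1.eq_or_lt with rfl | h1
    · exact rlr.mono subset_rfl (by omega)
    rcases (Nat.le_sub_one_of_lt h2).eq_or_lt with rfl | h2
    · exact Reach.refl _ _
    obtain ⟨a, ha, h3, h4⟩ := hblk i h1 h2
    exact (((hE a ha).reach_to_right i h3 h4).mono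
      ((hEB a ha).trans hBBO) le_rfl).trans (rlast a ha)
  refine ⟨B ∪ O, ?_, ?_, ?_, ?_, ?_, rleft, rright, ?_, ?_⟩
  · intro e he
    rcases Finset.mem_union.1 he with he | he
    · exact hBinc e he
    · exact hOinc e he
  · have hB : B.card + (f + 3) * q ≤ (f + 4) * (r - 1 - (l + 1)) := by
      calc B.card + (f + 3) * q ≤ ∑ a ∈ Finset.range q, ((E a).card + (f + 3)) := by
            rw [Finset.sum_add_distrib, Finset.sum_const, Finset.card_range, smul_eq_mul,
              mul_comm q]
            exact Nat.add_le_add_right Finset.card_biUnion_le _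
        _ ≤ ∑ a ∈ Finset.range q, (f + 4) * (c (a + 1) - c a) :=
            Finset.sum_le_sum fun a ha => (hE a (Finset.mem_range.1 ha)).card_add_le
        _ = (f + 4) * (r - 1 - (l + 1)) := by rw [← Finset.mul_sum, sum_block_sizes hc, hq, h0]
    have h1 := Finset.card_union_le B O
    have h2 : r - l = (r - 1 - (l + 1)) + 2 := by omega
    rw [h2, mul_add]
    omega
  · intro i
    have h1 := incidence_union_le B O i
    rcases le_or_gt i l with hi | hi
    · have := hBout i (Or.inl hi)
      have := hOdeg i
      omega
    rcases le_or_gt (r - 1) i with hi' | hi'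
    · have := hBout i (Or.inr hi')
      have := hOdeg i
      omega
    obtain ⟨a, ha, h3, h4⟩ := hblk i hi hi'
    have h5 := hBin i a h3 h4
    by_cases hiS : i ∈ S
    · have h6 : incidence (E a) i ≤ 4 * m + 4 := by
        simp only [S, Finset.mem_union, Finset.mem_insert, Finset.mem_singleton, Finset.mem_image,
          Finset.mem_range] at hiS
        rcases hiS with ((rfl | rfl) | ⟨a', ha', rfl⟩) | ⟨a', ha', rfl⟩
        · omega
        · omega
        · obtain rfl : a = a' := block_unique hc h3 h4 le_rfl (hs a' ha')
          exact (hE a ha).incidence_left_le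
        · have := hs a' ha'
          obtain rfl : a = a' := block_unique hc h3 h4 (by omega) (by omega)
          exact (hE a ha).incidence_right_le
      have := hOdeg i
      omega
    · have h6 : incidence O i = 0 := incidence_eq_zero fun e he => by
        obtain ⟨k1, k2⟩ := (hOS e he).1
        exact ⟨fun h => hiS (h ▸ k1), fun h => hiS (h ▸ k2)⟩
      have := (hE a ha).incidence_le i
      omega
  · have := incidence_union_le B O l
    have := hBout l (Or.inl le_rfl)
    have := hOdeg l
    omega
  · have := incidence_union_le B O (r - 1)
    have := hBout (r - 1) (Or.inr le_rfl)
    have := hOdeg (r - 1)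
    omega
  · intro i j hi hij hj
    rcases hi.eq_or_lt with rfl | hi
    · exact (rleft j hij.le hj).mono subset_rfl (by omega)
    rcases (Nat.le_sub_one_of_lt hj).eq_or_lt with rfl | hj
    · exact (rright i hi.le (by omega)).mono subset_rfl (by omega)
    obtain ⟨a, ha, ha1, ha2⟩ := hblk i hi (hij.trans hj)
    obtain ⟨b, hb, hb1, hb2⟩ := hblk j (hi.trans hij) hj
    rcases (block_le_of_le hc ha1 hb2 hij.le).eq_or_lt with rfl | hlt
    · exact ((hE a ha).reach i j ha1 hij hb2).mono ((hEB a ha).trans hBBO) (by omega)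
    · have r1 := ((hE a ha).reach_to_right i ha1 ha2).mono ((hEB a ha).trans hBBO) le_rfl
      have r2 : Reach (B ∪ O) 1 (c (a + 1) - 1) (c (a + 1)) := Reach.single
        (hOBO (hN (Finset.mem_image.2 ⟨a, Finset.mem_range.2 (by omega), rfl⟩)))
      have r3 : Reach (B ∪ O) h (c (a + 1)) (c b) := by
        rcases (Nat.succ_le_of_lt hlt).eq_or_lt with heq | hlt'
        · rw [← heq]; exact Reach.refl _ _
        · exact ((hF3 _ _ (Nat.zero_le _) hlt' hb).image c).mono (hG.trans hOBO) le_rfl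
      have r4 := ((hE b hb).reach_from_left j hb1 hb2).mono ((hEB b hb).trans hBBO) le_rfl
      exact (((r1.trans r2).trans r3).trans r4).mono subset_rfl (by omega)
  · have hspan : 0 ≤ x (r - 1) - x l := sub_nonneg.2 (hx (by omega))
    have hO : length x O ≤ ((f + 3) * m + 1) * (x (r - 1) - x l) := by
      refine (length_le_card_mul hx hOinc).trans (mul_le_mul_of_nonneg_right ?_ hspan)
      have : O.card ≤ (f + 3) * m + 1 :=
        hOcard.trans (Nat.add_le_add_right (Nat.mul_le_mul_left _ hqm) 1)
      exact_mod_cast this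
    have hB : length x B ≤ d * ((f + 3) * m + 1) * (x (r - 1) - x l) := by
      have hK : (0 : ℝ) ≤ d * ((f + 3) * m + 1) := by positivity
      calc length x B ≤ ∑ a ∈ Finset.range q, length x (E a) := by
            refine (Finset.sum_biUnion fun a ha a' ha' hne => ?_).le
            refine Finset.disjoint_left.2 fun e he he' => hne ?_
            have h1 := (hE a (Finset.mem_range.1 ha)).increasing e he
            have h2 := (hE a' (Finset.mem_range.1 ha')).increasing e he'
            exact block_unique hc h1.1 (by omega) h2.1 (by omega)
        _ ≤ ∑ a ∈ Finset.range q, d * ((f + 3) * m + 1) * (x (c (a + 1)) - x (c a)) := by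
            refine Finset.sum_le_sum fun a ha =>
              (hE a (Finset.mem_range.1 ha)).length_le.trans ?_
            exact mul_le_mul_of_nonneg_left (sub_le_sub_right (hx (Nat.sub_le _ _)) _) hK
        _ = d * ((f + 3) * m + 1) * (x (r - 1) - x (l + 1)) := by
            rw [← Finset.mul_sum, Finset.sum_range_sub (fun a => x (c a)), hq, h0]
        _ ≤ d * ((f + 3) * m + 1) * (x (r - 1) - x l) :=
            mul_le_mul_of_nonneg_left (sub_le_sub_left (hx (Nat.le_succ l)) _) hK
    calc length x (B ∪ O) ≤ length x B + length x O := length_union_le hx hBinc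
      _ ≤ _ := add_le_add hB hO
      _ = _ := by push_cast; ring

/-- Intervals with at most `m ^ d` points carry hierarchical spanners of depth `d`. -/
theorem exists_isHierarchy {x : ℕ → ℝ} (hx : Monotone x) {m h f : ℕ} (hm : 1 ≤ m)
    (hα : ∀ q ≤ m, HasShortcuts h f 0 q) :
    ∀ d l r : ℕ, l < r → r - l ≤ m ^ d → ∃ E, IsHierarchy x m h f d l r E := by
  intro d
  induction d with
  | zero =>
    intro l r hlr hn
    obtain rfl : r = l + 1 := by rw [pow_zero] at hn; omega
    exact ⟨∅, isHierarchy_singleton x m h f 0 l⟩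
  | succ d ih =>
    intro l r hlr hn
    rcases (Nat.succ_le_of_lt hlr).eq_or_lt with rfl | hlr'
    · exact ⟨∅, isHierarchy_singleton x m h f (d + 1) l⟩
    have hb : 0 < m ^ d := Nat.pow_pos hm
    obtain ⟨q, c, hc, h0, hq, hs, hgap, hqb⟩ :=
      exists_blocks (l := l + 1) (r := r - 1) (b := m ^ d) (by omega) hb
    have hqm : q ≤ m := by
      by_contra! hlt
      have := Nat.mul_le_mul_right (m ^ d) (Nat.succ_le_of_lt hlt)
      rw [Nat.succ_mul, mul_comm m, ← pow_succ] at this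
      omega
    have hE : ∀ a < q, ∃ E, IsHierarchy x m h f d (c a) (c (a + 1)) E := fun a ha =>
      ih _ _ (hs a ha) (by have := hgap a; omega)
    choose! E hE using hE
    exact IsHierarchy.step hx hlr' hqm hc h0 hq hs (hα q hqm) hE

theorem edgeWeight_nonneg (e : Sym2 P) : 0 ≤ edgeWeight e := by
  induction e with
  | _ p q => exact dist_nonneg

theorem dist_le_sum_edges {G : SimpleGraph P} {p q : P} (w : G.Walk p q) :
    dist p q ≤ (w.edges.map edgeWeight).sum := by
  induction w with
  | nil => simp
  | @cons u v z h w ih =>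
    rw [SimpleGraph.Walk.edges_cons, List.map_cons, List.sum_cons]
    exact (dist_triangle u v z).trans (add_le_add le_rfl ih)

theorem dist_le_totalWeight {T : Finset (Sym2 P)} (hT : IsGraphOn T) (hc : IsConnectedOn T)
    (p q : P) : dist p q ≤ totalWeight T := by
  classical
  obtain ⟨k, x, h0, hk, hx⟩ := hc p q
  let G := SimpleGraph.fromEdgeSet (T : Set (Sym2 P))
  have hreach : ∀ i : Fin (k + 1), G.Reachable (x 0) (x i) := by
    intro i
    induction i using Fin.induction with
    | zero => exact SimpleGraph.Reachable.refl _
    | succ i ih =>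
      refine ih.trans (SimpleGraph.Adj.reachable ?_)
      rw [SimpleGraph.fromEdgeSet_adj]
      exact ⟨hx i, fun h => hT _ (hx i) (Sym2.mk_isDiag_iff.2 h)⟩
  have hpq : G.Reachable p q := h0 ▸ hk ▸ hreach (Fin.last k)
  obtain ⟨w, hw⟩ := hpq.exists_isPath
  refine (dist_le_sum_edges w).trans ?_
  rw [← List.sum_toFinset edgeWeight hw.isTrail.edges_nodup]
  refine Finset.sum_le_sum_of_subset_of_nonneg (fun e he => ?_) fun e _ _ => edgeWeight_nonneg e
  have := w.edges_subset_edgeSet (List.mem_toFinset.1 he)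
  rw [SimpleGraph.edgeSet_fromEdgeSet] at this
  exact this.1

theorem exists_spanning_tree {V : Type} [Fintype V] [Nonempty V] :
    ∃ T : Finset (Sym2 V), IsGraphOn T ∧ IsConnectedOn T ∧ T.card = Fintype.card V - 1 := by
  classical
  obtain ⟨G, -, hG⟩ := (SimpleGraph.connected_top (V := V)).exists_isTree_le
  refine ⟨G.edgeFinset, ?_, ?_, ?_⟩
  · intro e he
    exact G.not_isDiag_of_mem_edgeFinset he
  · intro p q
    obtain ⟨w⟩ := hG.connected.preconnected p q
    refine ⟨w.length, fun i => w.getVert i, by simp, by simp, fun i => ?_⟩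
    rw [SimpleGraph.mem_edgeFinset, SimpleGraph.mem_edgeSet]
    simpa using w.adj_getVert_succ i.2
  · have := hG.card_edgeFinset
    omega

theorem dist_le_mstWeight [Fintype P] [Nonempty P] (p q : P) : dist p q ≤ mstWeight P := by
  obtain ⟨T, h1, h2, h3⟩ := exists_spanning_tree (V := P)
  refine le_csInf ⟨_, T, h1, h2, h3, rfl⟩ ?_
  rintro w ⟨T, h1, h2, -, rfl⟩
  exact dist_le_totalWeight h1 h2 p q

theorem IsSpannerPath.symm {H : Finset (Sym2 P)} {t : ℝ} {p q : P} {k : ℕ}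
    (h : IsSpannerPath H t p q k) : IsSpannerPath H t q p k := by
  obtain ⟨x, h0, hk, hx, hsum⟩ := h
  refine ⟨x ∘ Fin.rev, by simpa using hk, by simpa using h0, fun i => ?_, ?_⟩
  · have := hx i.rev
    rw [Sym2.eq_swap] at this
    simpa [Fin.rev_castSucc, Fin.rev_succ] using this
  · rw [dist_comm q p]
    refine le_trans (le_of_eq ?_) hsum
    rw [← Equiv.sum_comp Fin.revPerm]
    refine Finset.sum_congr rfl fun i _ => ?_
    simp only [Function.comp, Fin.revPerm_apply, Fin.rev_castSucc, Fin.rev_succ, Fin.rev_rev]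
    exact dist_comm _ _

theorem IsSpannerPath.cons {H : Finset (Sym2 P)} {p p' q : P} {k : ℕ} (hH : s(p, p') ∈ H)
    (hd : dist p p' + dist p' q ≤ dist p q) (h : IsSpannerPath H 1 p' q k) :
    IsSpannerPath H 1 p q (k + 1) := by
  obtain ⟨x, h0, hk, hx, hsum⟩ := h
  refine ⟨Fin.cons p x, rfl, by simpa using hk, fun i => ?_, ?_⟩
  · induction i using Fin.cases with
    | zero => simpa [h0] using hH
    | succ i => simpa using hx i
  · rw [Fin.sum_univ_succ]
    simp only [Fin.castSucc_zero, Fin.cons_zero, Fin.cons_succ, ← Fin.succ_castSucc, h0]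
    linarith

/-- Increasing paths are mapped by a monotone embedding in the line to `1`-spanner paths. -/
theorem Reach.exists_isSpannerPath {P : Finset ℝ} {g : ℕ → {x : ℝ // x ∈ P}} (hg : Monotone g)
    {E : Finset (ℕ × ℕ)} (hE : ∀ e ∈ E, e.1 < e.2) {H : Finset (Sym2 {x : ℝ // x ∈ P})}
    (hH : ∀ e ∈ E, s(g e.1, g e.2) ∈ H) {h i j : ℕ} (r : Reach E h i j) :
    i ≤ j ∧ ∃ k ≤ h, IsSpannerPath H 1 (g i) (g j) k := by
  induction r with
  | refl h i => exact ⟨le_rfl, 0, Nat.zero_le _, fun _ => g i, rfl, rfl, fun i => i.elim0, by simp⟩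
  | @step h i j z he _ ih =>
    obtain ⟨hjz, k, hk, hp⟩ := ih
    have hij := (hE _ he).le
    refine ⟨hij.trans hjz, k + 1, by omega, hp.cons (hH _ he) ?_⟩
    have h1 : (g i : ℝ) ≤ g j := hg hij
    have h2 : (g j : ℝ) ≤ g z := hg hjz
    rw [Subtype.dist_eq, Subtype.dist_eq, Subtype.dist_eq, Real.dist_eq, Real.dist_eq,
      Real.dist_eq, abs_of_nonpos (by linarith), abs_of_nonpos (by linarith),
      abs_of_nonpos (by linarith)]
    linarith

theorem invAck_spec (x : ℝ) : 1 ≤ invAck x ∧ x ≤ ack (invAck x) (invAck x) := by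
  refine Nat.sInf_mem (s := {k : ℕ | 1 ≤ k ∧ x ≤ ack k k}) ⟨⌈x⌉₊ + 1, by omega, ?_⟩
  refine (Nat.le_ceil x).trans ?_
  exact_mod_cast ((Nat.le_succ _).trans (lt_ack_left _ _).le)

/-- For the branching factor `min ⌊ρ⌋ n`, the depth is `O(1 + log_ρ n)` and the total length of
the hierarchy is `O(ρ log_ρ n)`. -/
theorem clog_branching_le {n : ℕ} (hn : 2 ≤ n) {ρ : ℝ} (hρ : 2 ≤ ρ) :
    (Nat.clog (min ⌊ρ⌋₊ n) n : ℝ) ≤ 1 + 2 * Real.logb ρ n ∧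
      (Nat.clog (min ⌊ρ⌋₊ n) n : ℝ) * (min ⌊ρ⌋₊ n : ℕ) ≤ 3 * (ρ * Real.logb ρ n) := by
  have hn' : (2 : ℝ) ≤ n := by exact_mod_cast hn
  have hlogρ : 0 < Real.log ρ := Real.log_pos (by linarith)
  have hlogn : 0 < Real.log n := Real.log_pos (by linarith)
  have hL : 0 < Real.logb ρ n := div_pos hlogn hlogρ
  rcases lt_or_ge (n : ℝ) ρ with hlt | hge
  · have hm : min ⌊ρ⌋₊ n = n := min_eq_right (Nat.le_floor hlt.le)
    have hd : Nat.clog n n = 1 := by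
      simpa using Nat.clog_pow n 1 hn
    rw [hm, hd, Nat.cast_one, one_mul]
    refine ⟨by linarith, ?_⟩
    rw [Real.logb, ← mul_div_assoc, ← mul_div_assoc, le_div_iff₀ hlogρ]
    have h1 : Real.log ρ = Real.log n + Real.log (ρ / n) := by
      rw [Real.log_div (by linarith) (by linarith)]; ring
    have h2 : Real.log (ρ / n) ≤ ρ / n - 1 := Real.log_le_sub_one_of_pos (by positivity)
    have h3 : (n : ℝ) * (ρ / n - 1) = ρ - n := by field_simp
    have h4 : (1 : ℝ) / 2 ≤ Real.log n := by
      have := Real.log_le_log (by norm_num) hn'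
      have := Real.log_two_gt_d9
      linarith
    have h5 : (n : ℝ) * Real.log ρ ≤ n * Real.log n + (ρ - n) := by
      rw [h1, mul_add, ← h3]
      gcongr
    nlinarith
  · have hfl : ⌊ρ⌋₊ ≤ n := Nat.floor_le_of_le hge
    rw [min_eq_left hfl]
    have hm2 : 2 ≤ ⌊ρ⌋₊ := Nat.le_floor (by exact_mod_cast hρ)
    have hmρ : (⌊ρ⌋₊ : ℝ) ≤ ρ := Nat.floor_le (by linarith)
    have hρm : ρ < ⌊ρ⌋₊ + 1 := Nat.lt_floor_add_one ρ
    generalize ⌊ρ⌋₊ = m at *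
    have hm2' : (2 : ℝ) ≤ m := by exact_mod_cast hm2
    have hlogm : 0 < Real.log m := Real.log_pos (by linarith)
    have hL1 : 1 ≤ Real.logb ρ n := by
      rw [Real.logb, one_le_div hlogρ]
      exact Real.log_le_log (by linarith) hge
    have hlog : Real.log ρ ≤ 2 * Real.log m := by
      rw [← Real.log_rpow (by linarith)]
      refine Real.log_le_log (by linarith) ?_
      norm_num
      nlinarith
    have hd : (Nat.clog m n : ℝ) ≤ 1 + 2 * Real.logb ρ n := by
      have hpos : 0 < Nat.clog m n := Nat.clog_pos hm2 hn
      have h1 : m ^ (Nat.clog m n - 1) < n := Nat.pow_pred_clog_lt_self hm2 hn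
      have h2 : (Nat.clog m n - 1 : ℕ) * Real.log m ≤ Real.log n := by
        rw [← Real.log_pow]
        exact Real.log_le_log (by positivity) (by exact_mod_cast h1.le)
      have h3 : ((Nat.clog m n - 1 : ℕ) : ℝ) = Nat.clog m n - 1 := by
        rw [Nat.cast_sub hpos]; simp
      rw [h3] at h2
      have h4 : (Nat.clog m n - 1 : ℝ) ≤ 2 * Real.logb ρ n := by
        rw [Real.logb, ← mul_div_assoc, le_div_iff₀ hlogρ]
        have h5 : (0 : ℝ) ≤ Nat.clog m n - 1 := by rw [← h3]; positivity
        nlinarith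
      linarith
    refine ⟨hd, ?_⟩
    calc (Nat.clog m n : ℝ) * m ≤ (3 * Real.logb ρ n) * ρ := by
          gcongr
          linarith
      _ = _ := by ring

theorem totalWeight_image_le {P : Finset ℝ} {g : ℕ → {x : ℝ // x ∈ P}} (hg : Monotone g)
    {E : Finset (ℕ × ℕ)} (hE : ∀ e ∈ E, e.1 < e.2) [DecidableEq (Sym2 {x : ℝ // x ∈ P})] :
    totalWeight (E.image fun e => s(g e.1, g e.2)) ≤ length (fun i => (g i : ℝ)) E := by
  have hw : ∀ e ∈ E, edgeWeight s(g e.1, g e.2) = (g e.2 : ℝ) - g e.1 := by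
    intro e he
    have : (g e.1 : ℝ) ≤ g e.2 := hg (hE e he).le
    change |(g e.1 : ℝ) - g e.2| = _
    rw [abs_of_nonpos (by linarith)]
    ring
  rw [length, ← Finset.sum_congr rfl hw]
  exact Finset.sum_image_le_of_nonneg fun e _ => edgeWeight_nonneg _

/-- **Optimal 1-dimensional spanners.** There is an absolute constant `C > 0` such that
every finite set `P ⊆ ℝ` of `n ≥ 2` points admits, for every `ρ ≥ 2`, a 1-spanner with
at most `C·n` edges, degree at most `C·ρ`, hop-diameter at most `C·(log_ρ n + α(ρ))`,
and lightness at most `C·ρ·log_ρ n`. -/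
theorem optimal_one_dimensional_spanners :
    ∃ C : ℝ, 0 < C ∧
      ∀ P : Finset ℝ, 2 ≤ P.card →
      ∀ ρ : ℝ, 2 ≤ ρ →
      ∃ H : Finset (Sym2 {x : ℝ // x ∈ P}),
        IsGraphOn H ∧
        IsSpanner H 1 ∧
        (H.card : ℝ) ≤ C * P.card ∧
        (∀ p, (degree H p : ℝ) ≤ C * ρ) ∧
        (∀ p q, ∃ k : ℕ,
          (k : ℝ) ≤ C * (Real.logb ρ P.card + invAck ρ) ∧
          IsSpannerPath H 1 p q k) ∧
        totalWeight H ≤ C * ρ * Real.logb ρ P.card * mstWeight {x : ℝ // x ∈ P} := by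
  classical
  refine ⟨1000, by norm_num, fun P hP ρ hρ => ?_⟩
  set n := P.card with hn
  set m := min ⌊ρ⌋₊ n
  set k := invAck ρ
  set d := Nat.clog m n
  let g : ℕ → {x : ℝ // x ∈ P} := fun i =>
    P.orderIsoOfFin hn.symm ⟨min i (n - 1), by omega⟩
  have hg : Monotone g := fun i j hij =>
    (P.orderIsoOfFin hn.symm).monotone (Fin.mk_le_mk.2 (min_le_min_right _ hij))
  have hginj : ∀ i j, i < n → j < n → g i = g j → i = j := by
    intro i j hi hj hij
    have := Fin.mk.inj_iff.1 ((P.orderIsoOfFin hn.symm).injective hij)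
    omega
  have hgsurj : ∀ p, ∃ i < n, g i = p := by
    intro p
    refine ⟨(P.orderIsoOfFin hn.symm).symm p, Fin.is_lt _, ?_⟩
    have hlt := ((P.orderIsoOfFin hn.symm).symm p).is_lt
    have : min ((P.orderIsoOfFin hn.symm).symm p : ℕ) (n - 1) =
      (P.orderIsoOfFin hn.symm).symm p := by omega
    simp only [g, this, Fin.eta, OrderIso.apply_symm_apply]
  obtain ⟨hk, hρk⟩ := invAck_spec ρ
  have hm2 : 2 ≤ m := le_min (Nat.le_floor (by exact_mod_cast hρ)) hP
  have hmρ : (m : ℝ) ≤ ρ :=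
    (Nat.cast_le.2 (min_le_left _ _)).trans (Nat.floor_le (by linarith))
  have hα : ∀ q ≤ m, HasShortcuts (2 * k + 3) 99 0 q := by
    intro q hq
    refine hasShortcuts_linear hk ?_
    have : (m : ℝ) ≤ ack k k := hmρ.trans hρk
    have : m ≤ ack k k := by exact_mod_cast this
    omega
  obtain ⟨hd1, hd2⟩ := clog_branching_le hP hρ
  have hL : 0 < Real.logb ρ n :=
    Real.logb_pos (by linarith) (by exact_mod_cast (show 1 < n by omega))
  obtain ⟨E, hE⟩ := exists_isHierarchy (x := fun i => (g i : ℝ)) hg (by omega) hα d 0 n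
    (by omega) (by simpa using Nat.le_pow_clog (by omega) n)
  have hinc : ∀ e ∈ E, e.1 < e.2 := fun e he => (hE.increasing e he).2.1
  let H := E.image fun e => s(g e.1, g e.2)
  have hpath : ∀ p q, ∃ t : ℕ, (t : ℝ) ≤ 1000 * (Real.logb ρ n + k) ∧
      IsSpannerPath H 1 p q t := by
    have key : ∀ i j, i ≤ j → j < n → ∃ t : ℕ, (t : ℝ) ≤ 1000 * (Real.logb ρ n + k) ∧
        IsSpannerPath H 1 (g i) (g j) t := by
      intro i j hij hj
      have hr : Reach E (2 * d + (2 * k + 3)) i j := by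
        rcases hij.eq_or_lt with rfl | hij
        · exact Reach.refl _ _
        · exact hE.reach i j (Nat.zero_le i) hij hj
      obtain ⟨-, t, ht, hp⟩ := hr.exists_isSpannerPath hg hinc
        fun e he => Finset.mem_image.2 ⟨e, he, rfl⟩
      refine ⟨t, ?_, hp⟩
      have ht' : (t : ℝ) ≤ 2 * d + (2 * k + 3) := by exact_mod_cast ht
      have hk' : (1 : ℝ) ≤ k := by exact_mod_cast hk
      linarith
    intro p q
    obtain ⟨i, hi, rfl⟩ := hgsurj p
    obtain ⟨j, hj, rfl⟩ := hgsurj q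
    rcases le_total i j with hij | hij
    · exact key i j hij hj
    · obtain ⟨t, ht, hp⟩ := key j i hij hi
      exact ⟨t, ht, hp.symm⟩
  refine ⟨H, ?_, ?_, ?_, ?_, hpath, ?_⟩
  · intro e he hdiag
    obtain ⟨e, heE, rfl⟩ := Finset.mem_image.1 he
    obtain ⟨-, h1, h2⟩ := hE.increasing e heE
    exact h1.ne (hginj _ _ (h1.trans h2) h2 (Sym2.mk_isDiag_iff.1 hdiag))
  · intro p q
    obtain ⟨t, -, hp⟩ := hpath p q
    exact ⟨t, hp⟩
  · have h1 : H.card ≤ E.card := Finset.card_image_le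
    have h2 := hE.card_add_le
    have h3 : H.card ≤ 1000 * n := by omega
    exact_mod_cast h3
  · intro p
    obtain ⟨i, hi, rfl⟩ := hgsurj p
    have h1 : degree H (g i) ≤ incidence E i := by
      have hsub : H.filter (fun e => g i ∈ e) ⊆
          (E.filter fun e => e.1 = i ∨ e.2 = i).image fun e => s(g e.1, g e.2) := by
        intro e he
        obtain ⟨heH, hie⟩ := Finset.mem_filter.1 he
        obtain ⟨e, heE, rfl⟩ := Finset.mem_image.1 heH
        obtain ⟨-, h1, h2⟩ := hE.increasing e heE
        refine Finset.mem_image.2 ⟨e, Finset.mem_filter.2 ⟨heE, ?_⟩, rfl⟩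
        rcases Sym2.mem_iff.1 hie with h | h
        · exact Or.inl (hginj _ _ hi (h1.trans h2) h).symm
        · exact Or.inr (hginj _ _ hi h2 h).symm
      have hdeg : degree H (g i) = (H.filter fun e => g i ∈ e).card := by
        unfold degree
        congr!
      rw [hdeg]
      exact (Finset.card_le_card hsub).trans Finset.card_image_le
    have h2 : (degree H (g i) : ℝ) ≤ 8 * m + 8 := by
      exact_mod_cast h1.trans (hE.incidence_le i)
    linarith
  · have : Nonempty {x : ℝ // x ∈ P} := ⟨g 0⟩
    have hspan : (g (n - 1) : ℝ) - g 0 ≤ mstWeight {x : ℝ // x ∈ P} :=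
      (le_abs_self _).trans (dist_le_mstWeight (g (n - 1)) (g 0))
    have hspan0 : (0 : ℝ) ≤ g (n - 1) - g 0 := sub_nonneg.2 (hg (Nat.zero_le _))
    have hm2' : (2 : ℝ) ≤ m := by exact_mod_cast hm2
    have hd0 : (0 : ℝ) ≤ d := Nat.cast_nonneg d
    have hcoef : (d : ℝ) * ((99 + 3) * m + 1) ≤ 1000 * ρ * Real.logb ρ n := by nlinarith
    calc totalWeight H ≤ length (fun i => (g i : ℝ)) E := totalWeight_image_le hg hinc
      _ ≤ d * ((99 + 3) * m + 1) * (g (n - 1) - g 0) := by exact_mod_cast hE.length_le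
      _ ≤ 1000 * ρ * Real.logb ρ n * mstWeight {x : ℝ // x ∈ P} :=
        mul_le_mul hcoef hspan hspan0 (by positivity)

end Stmt4
end
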